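/- arXiv:1211.2612 — 2 statements merged into one kernel-verified Lean document; each statement's English description precedes it below -/
import Mathlib

section
/- Let G be a finite group with a cyclic, index 2 subgroup. Then D(G) = d(G) + |[G,G]|, with d(G) = |G| - 1 if G is cyclic and d(G) = |G|/2 otherwise. -/
/-- The set of products of a multiset `S` over `G`: all elements obtained by
multiplying the terms of `S` in some order. -/
def prodSet {G : Type*} [Group G] (S : Multiset G) : Set G :=
  {g | ∃ l : List G, (l : Multiset G) = S ∧ l.prod = g}

/-- `S` is a product-one sequence if its terms can be ordered with product `1`. -/
def IsProductOne {G : Type*} [Group G] (S : Multiset G) : Prop :=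
  (1 : G) ∈ prodSet S

/-- `S` is product-one free if no nonempty sub-multiset is a product-one sequence. -/
def ProductOneFree {G : Type*} [Group G] (S : Multiset G) : Prop :=
  ∀ T : Multiset G, T ≤ S → T ≠ 0 → ¬ IsProductOne T

/-- `S` is a minimal product-one sequence (an atom): a nonempty product-one sequence
that cannot be factored into two nonempty product-one sub-multisets. -/
def IsMinimalProductOne {G : Type*} [Group G] (S : Multiset G) : Prop :=
  S ≠ 0 ∧ IsProductOne S ∧
    ¬ ∃ T T' : Multiset G, S = T + T' ∧ T ≠ 0 ∧ T' ≠ 0 ∧ IsProductOne T ∧ IsProductOne T'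

/-- The small Davenport constant: the supremum of lengths of product-one free sequences. -/
noncomputable def smallDavenport (G : Type*) [Group G] : ℕ∞ :=
  sSup {n : ℕ∞ | ∃ S : Multiset G, ProductOneFree S ∧ (S.card : ℕ∞) = n}

/-- The large Davenport constant: the supremum of lengths of minimal product-one sequences. -/
noncomputable def largeDavenport (G : Type*) [Group G] : ℕ∞ :=
  sSup {n : ℕ∞ | ∃ S : Multiset G, IsMinimalProductOne S ∧ (S.card : ℕ∞) = n}


namespace DavAux

theorem pig {ι M : Type*} [Group M] (N : Subgroup M) [Finite N] (f : ι → M) (l : List ι)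
    (hf : ∀ x ∈ l, f x ∈ N) (hl : Nat.card N ≤ l.length) :
    ∃ l1 l2 l3, l = l1 ++ l2 ++ l3 ∧ l2 ≠ [] ∧ (l2.map f).prod = 1 := by
  classical
  have hmem : ∀ i : ℕ, ((l.take i).map f).prod ∈ N := by
    intro i
    apply Subgroup.list_prod_mem
    intro x hx
    obtain ⟨y, hy, rfl⟩ := List.mem_map.1 hx
    exact hf y (List.mem_of_mem_take hy)
  let F : Fin (l.length + 1) → N := fun i => ⟨((l.take i).map f).prod, hmem i⟩
  have hni : ¬ Function.Injective F := by
    intro hinj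
    have := Nat.card_le_card_of_injective F hinj
    simp at this
    omega
  have key : ∀ i j : Fin (l.length + 1), i < j → F i = F j →
      ∃ l1 l2 l3, l = l1 ++ l2 ++ l3 ∧ l2 ≠ [] ∧ (l2.map f).prod = 1 := by
    intro i j hij hF
    have hij' : (i : ℕ) < j := hij
    refine ⟨l.take i, (l.take j).drop i, l.drop j, ?_, ?_, ?_⟩
    · have h1 : l.take i = (l.take j).take i := by
        rw [List.take_take, min_eq_left hij'.le]
      rw [h1, List.take_append_drop, List.take_append_drop]
    · intro h
      have := congrArg List.length h
      simp at this
      omega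
    · have h1 : l.take i = (l.take j).take i := by
        rw [List.take_take, min_eq_left hij'.le]
      have h2 : l.take j = l.take i ++ (l.take j).drop i := by
        rw [h1, List.take_append_drop]
      have h3 : ((l.take i).map f).prod = ((l.take j).map f).prod := congrArg Subtype.val hF
      have h4 : ((l.take j).map f).prod = ((l.take i).map f).prod * (((l.take j).drop i).map f).prod := by
        conv_lhs => rw [h2]
        rw [List.map_append, List.prod_append]
      rw [h4] at h3
      exact left_eq_mul.1 h3
  simp only [Function.Injective, not_forall] at hni
  obtain ⟨i, j, hF, hne⟩ := hni
  rcases lt_or_gt_of_ne hne with h | h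
  · exact key i j h hF
  · exact key j i h hF.symm

theorem zeroSum {ι A : Type*} [AddCommGroup A] (N : AddSubgroup A) [Finite N] (f : ι → A)
    (B : Multiset ι) (hf : ∀ x ∈ B, f x ∈ N) (hl : Nat.card N ≤ B.card) :
    ∃ U ≤ B, U ≠ 0 ∧ (U.map f).sum = 0 := by
  obtain ⟨l, rfl⟩ := Quot.exists_rep B
  have : Finite (AddSubgroup.toSubgroup N) := ‹Finite N›
  obtain ⟨l1, l2, l3, h1, h2, h3⟩ := pig (AddSubgroup.toSubgroup N)
    (fun x => Multiplicative.ofAdd (f x)) l (fun x hx => hf x hx) hl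
  refine ⟨(l2 : Multiset ι), ?_, ?_, ?_⟩
  · change (l2 : Multiset ι) ≤ (l : Multiset ι)
    rw [h1, ← Multiset.coe_add, ← Multiset.coe_add, add_comm (l1 : Multiset ι), add_assoc]
    exact Multiset.le_add_right _ _
  · simpa using h2
  · rw [Multiset.map_coe, Multiset.sum_coe]
    have := congrArg Multiplicative.toAdd h3
    rw [toAdd_list_sum, List.map_map] at this
    exact this

section
variable {G : Type*} [Group G]

theorem prodSet_mul {S T : Multiset G} {g h : G} (hg : g ∈ prodSet S) (hh : h ∈ prodSet T) :
    g * h ∈ prodSet (S + T) := by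
  obtain ⟨l, rfl, rfl⟩ := hg
  obtain ⟨k, rfl, rfl⟩ := hh
  exact ⟨l ++ k, by simp, by simp⟩

theorem splits_of_gt [Finite G] {S : Multiset G} (hS : IsMinimalProductOne S) :
    S.card ≤ Nat.card G := by
  by_contra! hlt
  obtain ⟨h0, ⟨l, rfl, hl⟩, hmin⟩ := hS
  cases l with
  | nil => simp at h0
  | cons x l =>
    obtain ⟨l1, l2, l3, h1, h2, h3⟩ := pig (⊤ : Subgroup G) id l (by simp) (by
      simp at hlt ⊢; omega)
    rw [List.map_id] at h3
    subst h1
    apply hmin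
    refine ⟨(l2 : Multiset G), ((x :: (l1 ++ l3) : List G) : Multiset G), ?_, by simpa using h2,
      by simp, ⟨l2, rfl, h3⟩, ⟨_, rfl, ?_⟩⟩
    · rw [Multiset.coe_add, Multiset.coe_eq_coe]
      have : (l2 ++ x :: (l1 ++ l3)).Perm (x :: (l1 ++ l3) ++ l2) := List.perm_append_comm
      refine List.Perm.trans ?_ this.symm
      simp only [List.cons_append, List.append_assoc]
      exact (List.Perm.append_left l1 List.perm_append_comm).cons x
    · simp [h3] at hl ⊢
      exact hl

theorem free_lt [Finite G] {S : Multiset G} (hS : Nat.card G ≤ S.card) :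
    ∃ U ≤ S, U ≠ 0 ∧ IsProductOne U := by
  obtain ⟨l, rfl⟩ := Quot.exists_rep S
  obtain ⟨l1, l2, l3, h1, h2, h3⟩ := pig (⊤ : Subgroup G) id l (by simp) (by
      simpa using hS)
  rw [List.map_id] at h3
  refine ⟨(l2 : Multiset G), ?_, by simpa using h2, ⟨l2, rfl, h3⟩⟩
  change (l2 : Multiset G) ≤ (l : Multiset G)
  rw [h1, ← Multiset.coe_add, ← Multiset.coe_add, add_comm (l1 : Multiset G), add_assoc]
  exact Multiset.le_add_right _ _

theorem prodOne_abel {C : Type*} [CommGroup C] (q : G →* C) {S : Multiset G}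
    (hS : IsProductOne S) : (S.map q).prod = 1 := by
  obtain ⟨l, rfl, hl⟩ := hS
  rw [Multiset.map_coe, Multiset.prod_coe, ← map_list_prod, hl, map_one]

end

/-! subset sums -/
section
variable {ι A : Type*} [AddCommGroup A] [Finite A]

def subs (f : ι → A) (B : Multiset ι) : Set A := {x | ∃ T ≤ B, (T.map f).sum = x}

omit [Finite A] in
theorem subs_mono (f : ι → A) {B C : Multiset ι} (h : B ≤ C) : subs f B ⊆ subs f C := by
  rintro x ⟨T, hT, rfl⟩
  exact ⟨T, hT.trans h, rfl⟩

omit [Finite A] in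
theorem zero_mem_subs (f : ι → A) (B : Multiset ι) : (0 : A) ∈ subs f B :=
  ⟨0, Multiset.zero_le _, by simp⟩

omit [Finite A] in
theorem mem_subs_add (f : ι → A) {B C : Multiset ι} {x : A} :
    x ∈ subs f (B + C) ↔ ∃ y ∈ subs f B, ∃ z ∈ subs f C, y + z = x := by
  classical
  constructor
  · rintro ⟨T, hT, rfl⟩
    refine ⟨_, ⟨T ∩ B, Multiset.inter_le_right, rfl⟩, _, ⟨T - B, ?_, rfl⟩, ?_⟩
    · rw [tsub_le_iff_left]; exact hT
    · rw [← Multiset.sum_add, ← Multiset.map_add, add_comm, Multiset.sub_add_inter]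
  · rintro ⟨y, ⟨T, hT, rfl⟩, z, ⟨T', hT', rfl⟩, rfl⟩
    exact ⟨T + T', add_le_add hT hT', by simp⟩

omit [Finite A] in
theorem mem_subs_singleton (f : ι → A) (b : ι) {x : A} :
    x ∈ subs f {b} ↔ x = 0 ∨ x = f b := by
  constructor
  · rintro ⟨T, hT, rfl⟩
    rcases Multiset.le_singleton.1 hT with rfl | rfl <;> simp
  · rintro (rfl | rfl)
    · exact zero_mem_subs _ _
    · exact ⟨{b}, le_rfl, by simp⟩

def stab (X : Set A) : AddSubgroup A where
  carrier := {x | ∀ y, x + y ∈ X ↔ y ∈ X}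
  zero_mem' := by simp
  add_mem' := by
    intro a b ha hb y
    simp only [Set.mem_setOf_eq] at ha hb
    rw [add_assoc, ha, hb]
  neg_mem' := by
    intro a ha y
    have := ha (-a + y)
    simp at this
    exact this.symm

/-- for finite sets, one-sided inclusion suffices -/
theorem mem_stab_of {X : Set A} {x : A} (h : ∀ y ∈ X, x + y ∈ X) : x ∈ stab X := by
  intro y
  refine ⟨fun hy => ?_, h y⟩
  have hs : (fun y => x + y) '' X = X := by
    apply Set.eq_of_subset_of_ncard_le
    · rintro _ ⟨z, hz, rfl⟩; exact h z hz
    · rw [Set.ncard_image_of_injective _ (add_right_injective x)]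
    · exact Set.toFinite _
  rw [← hs] at hy
  obtain ⟨z, hz, hzy⟩ := hy
  have : z = y := add_left_cancel hzy
  rwa [← this]

theorem periodic_card {X Y : Set A} (L : AddSubgroup A) (hX : L ≤ stab X) (hY : L ≤ stab Y)
    (h : X ⊂ Y) : X.ncard + Nat.card L ≤ Y.ncard := by
  obtain ⟨hsub, hn⟩ := h
  obtain ⟨y, hy, hyX⟩ := Set.not_subset.1 hn
  have hi : ((fun z => z + y) '' (L : Set A)).ncard = Nat.card L := by
    rw [Set.ncard_image_of_injective _ (add_left_injective y)]; rfl
  rw [← hi, ← Set.ncard_union_eq]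
  · apply Set.ncard_le_ncard _ (Set.toFinite _)
    apply Set.union_subset hsub
    rintro _ ⟨z, hz, rfl⟩
    exact (hY hz y).2 hy
  · rw [Set.disjoint_left]
    rintro _ hx ⟨z, hz, rfl⟩
    exact hyX ((hX hz y).1 hx)

theorem stab_add (f : ι → A) (B C : Multiset ι) (L : AddSubgroup A) (h : L ≤ stab (subs f B)) :
    L ≤ stab (subs f (B + C)) := by
  intro x hx
  apply mem_stab_of
  intro y hy
  rw [mem_subs_add] at hy ⊢
  obtain ⟨b, hb, c, hc, rfl⟩ := hy
  exact ⟨x + b, (h hx b).2 hb, c, hc, by abel⟩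

theorem chain (f : ι → A) (L : AddSubgroup A) (B0 B1 : Multiset ι) (hL : L ≤ stab (subs f B0)) :
    ∃ W ≤ B1, subs f (B0 + W) = subs f (B0 + B1) ∧
      W.card * Nat.card L + (subs f B0).ncard ≤ (subs f (B0 + B1)).ncard := by
  induction B1 using Multiset.induction_on with
  | empty => exact ⟨0, le_rfl, rfl, by simp⟩
  | cons b B1 ih =>
    obtain ⟨W, hW, h1, h2⟩ := ih
    have hle : subs f (B0 + B1) ⊆ subs f (B0 + b ::ₘ B1) :=
      subs_mono f (add_le_add le_rfl (Multiset.le_cons_self _ _))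
    by_cases heq : subs f (B0 + B1) = subs f (B0 + b ::ₘ B1)
    · exact ⟨W, hW.trans (Multiset.le_cons_self _ _), by rw [h1, heq], by rwa [← heq]⟩
    · refine ⟨b ::ₘ W, Multiset.cons_le_cons b hW, ?_, ?_⟩
      · ext x
        rw [← Multiset.singleton_add, ← Multiset.singleton_add, add_left_comm, add_left_comm B0,
          mem_subs_add, mem_subs_add, h1]
      · have := periodic_card L (stab_add f B0 B1 L hL) (stab_add f B0 (b ::ₘ B1) L hL)
          (HasSubset.Subset.ssubset_of_ne hle heq)
        rw [Multiset.card_cons, add_mul]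
        omega

theorem mem_stab_of_mem_sub [DecidableEq ι] (f : ι → A) {W B : Multiset ι} (hW : W ≤ B)
    (h : subs f W = subs f B) {b : ι} (hb : b ∈ B - W) : f b ∈ stab (subs f B) := by
  apply mem_stab_of
  intro y hy
  rw [← h] at hy
  have h2 : {b} + W ≤ B := by
    rw [← le_tsub_iff_right hW]
    exact Multiset.singleton_le.2 hb
  apply subs_mono f h2
  rw [mem_subs_add]
  exact ⟨f b, (mem_subs_singleton f b).2 (Or.inr rfl), y, hy, rfl⟩

end
end DavAux

namespace DavAux

structure Dat (G : Type*) [Group G] (n : ℕ) where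
  a : ZMod n → G
  a_add : ∀ x y, a (x + y) = a x * a y
  a_inj : Function.Injective a
  t : G
  r : ZMod n
  t_out : ∀ x, a x ≠ t
  out_mul : ∀ y z : G, (∀ x, a x ≠ y) → (∀ x, a x ≠ z) → ∃ x, a x = y * z
  conj : ∀ y : G, (∀ x, a x ≠ y) → ∀ x, y * a x = a (r * x) * y

namespace Dat
variable {G : Type*} [Group G] {n : ℕ} (d : Dat G n)

def inn (g : G) : Prop := ∃ x, d.a x = g

theorem not_inn {g : G} : ¬ d.inn g ↔ ∀ x, d.a x ≠ g := by simp [inn]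

open Classical in
noncomputable def lam (g : G) : ZMod n := if h : d.inn g then h.choose else 0

theorem a_lam {g : G} (h : d.inn g) : d.a (d.lam g) = g := by
  rw [lam, dif_pos h]; exact h.choose_spec

theorem inn_a (x : ZMod n) : d.inn (d.a x) := ⟨x, rfl⟩

theorem lam_a (x : ZMod n) : d.lam (d.a x) = x := d.a_inj (d.a_lam (d.inn_a x))

theorem a_zero : d.a 0 = 1 := by
  have := d.a_add 0 0
  simpa using this

theorem a_eq_one {x : ZMod n} : d.a x = 1 ↔ x = 0 := by
  rw [← d.a_zero, d.a_inj.eq_iff]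

theorem a_neg (x : ZMod n) : d.a (-x) = (d.a x)⁻¹ := by
  rw [eq_inv_iff_mul_eq_one, ← d.a_add, neg_add_cancel, a_zero]

theorem inn_one : d.inn 1 := ⟨0, d.a_zero⟩

theorem inn_mul {g h : G} (hg : d.inn g) (hh : d.inn h) : d.inn (g * h) := by
  obtain ⟨x, rfl⟩ := hg
  obtain ⟨y, rfl⟩ := hh
  exact ⟨x + y, d.a_add x y⟩

theorem inn_inv {g : G} (hg : d.inn g) : d.inn g⁻¹ := by
  obtain ⟨x, rfl⟩ := hg
  exact ⟨-x, d.a_neg x⟩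

theorem inn_mul_iff_left {g h : G} (hg : d.inn g) : d.inn (g * h) ↔ d.inn h := by
  refine ⟨fun H => ?_, d.inn_mul hg⟩
  have := d.inn_mul (d.inn_inv hg) H
  simpa using this

theorem inn_mul_iff_right {g h : G} (hg : d.inn h) : d.inn (g * h) ↔ d.inn g := by
  refine ⟨fun H => ?_, fun H => d.inn_mul H hg⟩
  have := d.inn_mul H (d.inn_inv hg)
  simpa using this

theorem inn_out {y z : G} (hy : ¬ d.inn y) (hz : ¬ d.inn z) : d.inn (y * z) :=
  d.out_mul y z (d.not_inn.1 hy) (d.not_inn.1 hz)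

theorem t_not : ¬ d.inn d.t := d.not_inn.2 d.t_out

theorem inv_not {y : G} (hy : ¬ d.inn y) : ¬ d.inn y⁻¹ := fun h => hy (by simpa using d.inn_inv h)

theorem conj' {y : G} (hy : ¬ d.inn y) (x : ZMod n) : y * d.a x = d.a (d.r * x) * y :=
  d.conj y (d.not_inn.1 hy) x

theorem lam_mul {g h : G} (hg : d.inn g) (hh : d.inn h) : d.lam (g * h) = d.lam g + d.lam h := by
  apply d.a_inj
  rw [d.a_lam (d.inn_mul hg hh), d.a_add, d.a_lam hg, d.a_lam hh]

theorem r_sq : d.r * d.r = 1 := by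
  obtain ⟨s, hs⟩ := d.inn_out d.t_not d.t_not
  have h1 : d.t * d.t * d.a 1 = d.a (d.r * d.r) * (d.t * d.t) := by
    rw [mul_assoc, d.conj' d.t_not, ← mul_assoc, d.conj' d.t_not]
    simp [mul_assoc]
  rw [← hs, ← d.a_add, ← d.a_add] at h1
  have := d.a_inj h1
  linear_combination -this

/-- swapping a pair of outer elements -/
theorem lam_swap {y z : G} (hy : ¬ d.inn y) (hz : ¬ d.inn z) :
    d.lam (z * y) = d.r * d.lam (y * z) := by
  apply d.a_inj
  rw [d.a_lam (d.inn_out hz hy)]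
  have := d.conj' hz (d.lam (y * z))
  rw [d.a_lam (d.inn_out hy hz)] at this
  rw [← mul_left_inj z, ← this, mul_assoc]

theorem lam_sq {y : G} (hy : ¬ d.inn y) : (d.r - 1) * d.lam (y * y) = 0 := by
  have := d.lam_swap hy hy
  linear_combination -this

/-- the map `x ↦ (r-1) x` -/
def del : ZMod n →+ ZMod n := AddMonoidHom.mulLeft (d.r - 1)

theorem del_apply (x : ZMod n) : d.del x = (d.r - 1) * x := rfl

theorem del_r (x : ZMod n) : d.del (d.r * x) = - d.del x := by
  rw [del_apply, del_apply]
  linear_combination x * d.r_sq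

/-- units: a single inner element or a pair of outer elements -/
def IsPair (u : List G) : Prop := ∃ y z, ¬ d.inn y ∧ ¬ d.inn z ∧ u = [y, z]
def IsSingle (u : List G) : Prop := ∃ y, d.inn y ∧ u = [y]
def IsUnit' (u : List G) : Prop := d.IsSingle u ∨ d.IsPair u

noncomputable def val (u : List G) : ZMod n := d.lam u.prod

def flat (B : Multiset (List G)) : Multiset G := (B.map (fun u : List G => (u : Multiset G))).sum

omit [Group G] in
theorem flat_add (B C : Multiset (List G)) : flat (B + C) = flat B + flat C := by simp [flat]
omit [Group G] in
theorem flat_cons (u : List G) (C : Multiset (List G)) : flat (u ::ₘ C) = (u : Multiset G) + flat C := by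
  simp [flat]
omit [Group G] in
theorem flat_zero : flat (0 : Multiset (List G)) = 0 := by simp [flat]
omit [Group G] in
theorem flat_le {B C : Multiset (List G)} (h : B ≤ C) : flat B ≤ flat C := by
  obtain ⟨D, rfl⟩ := Multiset.le_iff_exists_add.1 h
  rw [flat_add]; exact Multiset.le_add_right _ _

noncomputable def dv (u : List G) : ZMod n := d.del (d.val u)

theorem unit_inn {u : List G} (h : d.IsUnit' u) : d.inn u.prod := by
  rcases h with ⟨y, hy, rfl⟩ | ⟨y, z, hy, hz, rfl⟩
  · simpa using hy
  · simpa using d.inn_out hy hz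

theorem unit_ne {u : List G} (h : d.IsUnit' u) : u ≠ [] := by
  rcases h with ⟨y, hy, rfl⟩ | ⟨y, z, hy, hz, rfl⟩ <;> simp

/-- untwisted realization -/
theorem flat_prod (B : Multiset (List G)) (hB : ∀ u ∈ B, d.inn u.prod) :
    d.a (B.map d.val).sum ∈ prodSet (flat B) := by
  induction B using Multiset.induction_on with
  | empty => exact ⟨[], by simp [flat], by simp [d.a_zero]⟩
  | cons u B ih =>
    rw [Multiset.map_cons, Multiset.sum_cons, d.a_add, flat_cons]
    apply prodSet_mul
    · exact ⟨u, rfl, (d.a_lam (hB u (by simp))).symm⟩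
    · exact ih (fun v hv => hB v (by simp [hv]))

theorem flat_ne {B : Multiset (List G)} (hB : ∀ u ∈ B, u ≠ []) (h : B ≠ 0) : flat B ≠ 0 := by
  obtain ⟨u, hu⟩ := Multiset.exists_mem_of_ne_zero h
  obtain ⟨C, rfl⟩ := Multiset.exists_cons_of_mem hu
  rw [flat_cons]
  have := hB u hu
  intro h
  simp at h
  exact this h.1

theorem flat_one (B : Multiset (List G)) (hB : ∀ u ∈ B, d.inn u.prod)
    (h : (B.map d.val).sum = 0) : IsProductOne (flat B) := by
  have := d.flat_prod B hB
  rwa [h, d.a_zero] at this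

/-- twisted realization for pairs -/
theorem pairs_real (P : Multiset (List G)) (hP : ∀ u ∈ P, d.IsPair u) {x : ZMod n}
    (hx : x ∈ subs d.dv P) : d.a ((P.map d.val).sum + x) ∈ prodSet (flat P) := by
  induction P using Multiset.induction_on generalizing x with
  | empty =>
    obtain ⟨T, hT, rfl⟩ := hx
    rw [Multiset.le_zero.1 hT]
    exact ⟨[], by simp [flat], by simp [d.a_zero]⟩
  | cons u P ih =>
    rw [← Multiset.singleton_add, mem_subs_add] at hx
    obtain ⟨b, hb, c, hc, rfl⟩ := hx
    have h1 := ih (fun v hv => hP v (by simp [hv])) hc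
    rw [flat_cons, Multiset.map_cons, Multiset.sum_cons, add_add_add_comm, d.a_add]
    refine prodSet_mul ?_ h1
    obtain ⟨y, z, hy, hz, rfl⟩ := hP u (by simp)
    rcases (mem_subs_singleton _ _).1 hb with rfl | rfl
    · refine ⟨[y, z], rfl, ?_⟩
      simp [val, d.a_lam (d.inn_out hy hz)]
    · refine ⟨[z, y], ?_, ?_⟩
      · rw [Multiset.coe_eq_coe]; exact List.Perm.swap _ _ _
      · have : d.val [y, z] + d.dv [y, z] = d.lam (z * y) := by
          rw [d.lam_swap hy hz, dv, del_apply]; simp [val]; ring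
        rw [this, d.a_lam (d.inn_out hz hy)]; simp

theorem single_sum (I : Multiset (List G)) (hI : ∀ u ∈ I, d.IsSingle u) :
    d.a (I.map d.val).sum ∈ prodSet (flat I) :=
  d.flat_prod I (fun u hu => d.unit_inn (Or.inl (hI u hu)))

/-- twisted realization -/
theorem real (B : Multiset (List G)) (hB : ∀ u ∈ B, d.IsUnit' u) (p : List G) (hp : p ∈ B)
    (hpp : d.IsPair p) {x : ZMod n} (hx : x ∈ subs d.dv B) :
    d.a ((B.map d.val).sum + x) ∈ prodSet (flat B) := by
  classical
  obtain ⟨C, rfl⟩ := Multiset.exists_cons_of_mem hp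
  clear hp
  have hC : ∃ I P, C = I + P ∧ (∀ u ∈ I, d.IsSingle u) ∧ ∀ u ∈ P, d.IsPair u := by
    refine ⟨C.filter d.IsSingle, C.filter (fun u => ¬ d.IsSingle u),
      (Multiset.filter_add_not _ _).symm, fun u hu => (Multiset.mem_filter.1 hu).2, fun u hu => ?_⟩
    have := Multiset.mem_filter.1 hu
    exact (hB u (by simp [this.1])).resolve_left this.2
  obtain ⟨I, P, rfl, hI, hP⟩ := hC
  clear hB
  have e : p ::ₘ (I + P) = ({p} + I) + P := by simp
  rw [e] at hx ⊢
  obtain ⟨b, hb, c, hc, rfl⟩ := (mem_subs_add _).1 hx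
  rw [Multiset.map_add, Multiset.sum_add, flat_add, add_add_add_comm, d.a_add]
  refine prodSet_mul ?_ (d.pairs_real P hP hc)
  clear hx hc hP e
  obtain ⟨b1, hb1, b2, ⟨T, hT, rfl⟩, rfl⟩ := (mem_subs_add _).1 hb
  obtain ⟨T', rfl⟩ := Multiset.le_iff_exists_add.1 hT
  have hdT : (T.map d.dv).sum = d.del (T.map d.val).sum := by
    rw [map_multiset_sum, Multiset.map_map]; rfl
  obtain ⟨l, hl, hl2⟩ := d.single_sum T (fun u hu => hI u (by simp [hu]))
  obtain ⟨l', hl', hl2'⟩ := d.single_sum T' (fun u hu => hI u (by simp [hu]))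
  obtain ⟨y, z, hy, hz, rfl⟩ := hpp
  have main : ∀ y z, ¬ d.inn y → ¬ d.inn z → ([y, z] : List G).prod ∈ prodSet (([y, z] : List G) : Multiset G) →
      d.a (d.lam (y * z) + ((T.map d.val).sum + (T'.map d.val).sum + (T.map d.dv).sum)) ∈
        prodSet ((([y, z] : List G) : Multiset G) + flat (T + T')) := by
    intro y z hy hz _
    refine ⟨[y] ++ l ++ [z] ++ l', ?_, ?_⟩
    · rw [flat_add, ← hl, ← hl', Multiset.coe_add, Multiset.coe_add, Multiset.coe_eq_coe,
        ← List.append_assoc]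
      apply List.Perm.append_right
      simp only [List.cons_append, List.nil_append]
      apply List.Perm.cons
      exact List.perm_append_comm
    · simp only [List.prod_append, List.prod_singleton]
      rw [hl2, hl2', hdT, d.conj' hy, mul_assoc _ y z, ← d.a_lam (d.inn_out hy hz), ← d.a_add,
        ← d.a_add, d.del_apply, d.lam_a]
      congr 1
      ring
  have e1 : flat ({[y, z]} + (T + T')) = (([y, z] : List G) : Multiset G) + flat (T + T') := by
    rw [Multiset.singleton_add, flat_cons]
  rw [e1]
  have e2 : (Multiset.map d.val ({[y, z]} + (T + T'))).sum =
      d.lam (y * z) + ((T.map d.val).sum + (T'.map d.val).sum) := by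
    simp [val]
  rw [e2]
  rcases (mem_subs_singleton _ _).1 hb1 with rfl | rfl
  · have := main y z hy hz ⟨_, rfl, rfl⟩
    convert this using 2
    ring
  · have := main z y hz hy ⟨_, rfl, rfl⟩
    have e3 : (([z, y] : List G) : Multiset G) = (([y, z] : List G) : Multiset G) := by
      rw [Multiset.coe_eq_coe]; exact List.Perm.swap _ _ _
    rw [e3] at this
    convert this using 2
    rw [d.lam_swap hy hz, dv, d.del_apply]
    simp only [val, List.prod_cons, List.prod_nil, mul_one]
    ring

theorem subs_symm (B : Multiset (List G)) {x : ZMod n} (hx : x ∈ subs d.dv B) :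
    d.del (B.map d.val).sum - x ∈ subs d.dv B := by
  obtain ⟨T, hT, rfl⟩ := hx
  obtain ⟨T', rfl⟩ := Multiset.le_iff_exists_add.1 hT
  refine ⟨T', Multiset.le_add_left _ _, ?_⟩
  have hdT : ∀ T : Multiset (List G), (T.map d.dv).sum = d.del (T.map d.val).sum := by
    intro T
    rw [map_multiset_sum, Multiset.map_map]; rfl
  rw [hdT, hdT, Multiset.map_add, Multiset.sum_add, map_add]
  abel

/-- decomposition into units -/
theorem decomp (l : List G) :
    (d.inn l.prod → ∃ B : Multiset (List G), (∀ u ∈ B, d.IsUnit' u) ∧ flat B = (l : Multiset G) ∧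
      ∃ x ∈ subs d.dv B, l.prod = d.a ((B.map d.val).sum + x)) ∧
    (¬ d.inn l.prod → ∃ B : Multiset (List G), ∃ y, ¬ d.inn y ∧ (∀ u ∈ B, d.IsUnit' u) ∧
      flat B + {y} = (l : Multiset G) ∧
      ∃ x ∈ subs d.dv B, l.prod = d.a ((B.map d.val).sum + x) * y) := by
  induction l with
  | nil =>
    refine ⟨fun _ => ⟨0, by simp, by simp [flat], 0, zero_mem_subs _ _, by simp [d.a_zero]⟩,
      fun h => (h (by simpa using d.inn_one)).elim⟩
  | cons g l ih =>
    rw [List.prod_cons]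
    by_cases hg : d.inn g
    · rw [d.inn_mul_iff_left hg]
      have hv : d.a (d.val [g]) = g := by simp [val, d.a_lam hg]
      have hs : ∀ B x, x ∈ subs d.dv B → x ∈ subs d.dv ([g] ::ₘ B) := fun B x hx =>
        subs_mono _ (Multiset.le_cons_self _ _) hx
      constructor
      · intro h
        obtain ⟨B, hB, hf, x, hx, hp⟩ := ih.1 h
        refine ⟨[g] ::ₘ B, ?_, ?_, x, hs B x hx, ?_⟩
        · intro u hu
          rcases Multiset.mem_cons.1 hu with rfl | hu
          · exact Or.inl ⟨g, hg, rfl⟩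
          · exact hB u hu
        · rw [flat_cons, hf]; rfl
        · rw [Multiset.map_cons, Multiset.sum_cons, add_assoc, d.a_add, hv, hp]
      · intro h
        obtain ⟨B, y, hy, hB, hf, x, hx, hp⟩ := ih.2 h
        refine ⟨[g] ::ₘ B, y, hy, ?_, ?_, x, hs B x hx, ?_⟩
        · intro u hu
          rcases Multiset.mem_cons.1 hu with rfl | hu
          · exact Or.inl ⟨g, hg, rfl⟩
          · exact hB u hu
        · rw [flat_cons, add_assoc, hf]; rfl
        · rw [Multiset.map_cons, Multiset.sum_cons, add_assoc, d.a_add, hv, hp, mul_assoc]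
    · have hr : ∀ B : Multiset (List G), ∀ x, x ∈ subs d.dv B → ∃ x' ∈ subs d.dv B,
          d.r * ((B.map d.val).sum + x) = (B.map d.val).sum + x' := by
        intro B x hx
        refine ⟨_, d.subs_symm B hx, ?_⟩
        obtain ⟨T, hT, rfl⟩ := hx
        have hdT : (T.map d.dv).sum = d.del (T.map d.val).sum := by
          rw [map_multiset_sum, Multiset.map_map]; rfl
        rw [hdT, d.del_apply, d.del_apply]
        linear_combination (T.map d.val).sum * d.r_sq
      constructor
      · intro h
        have hl : ¬ d.inn l.prod := fun h' => hg ((d.inn_mul_iff_right h').1 h)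
        obtain ⟨B, y, hy, hB, hf, x, hx, hp⟩ := ih.2 hl
        obtain ⟨x', hx', he⟩ := hr B x hx
        refine ⟨[g, y] ::ₘ B, ?_, ?_, x', subs_mono _ (Multiset.le_cons_self _ _) hx', ?_⟩
        · intro u hu
          rcases Multiset.mem_cons.1 hu with rfl | hu
          · exact Or.inr ⟨g, y, hg, hy, rfl⟩
          · exact hB u hu
        · rw [flat_cons, ← Multiset.cons_coe g l, ← hf, add_comm (flat B)]
          change (g ::ₘ y ::ₘ (0 : Multiset G)) + flat B = _
          simp
        · rw [Multiset.map_cons, Multiset.sum_cons, hp, ← mul_assoc, d.conj' hg, he, mul_assoc,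
            ← d.a_lam (d.inn_out hg hy), ← d.a_add]
          congr 1
          simp [val]
          ring
      · intro h
        have hl : d.inn l.prod := by
          by_contra h'
          exact h (d.inn_out hg h')
        obtain ⟨B, hB, hf, x, hx, hp⟩ := ih.1 hl
        obtain ⟨x', hx', he⟩ := hr B x hx
        refine ⟨B, g, hg, hB, ?_, x', hx', ?_⟩
        · rw [hf, add_comm]; rfl
        · rw [hp, d.conj' hg, he]

end Dat
end DavAux

namespace DavAux

theorem exists_le_card {α : Type*} (S : Multiset α) {k : ℕ} (h : k ≤ S.card) :
    ∃ T ≤ S, T.card = k := by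
  obtain ⟨l, rfl⟩ := Quot.exists_rep S
  refine ⟨(l.take k : Multiset α), (List.take_sublist k l).subperm, ?_⟩
  have : k ≤ l.length := h
  simpa using this

theorem dup {α β : Type*} (f : α → β) (O : Multiset α) (h : ¬ (O.map f).Nodup) :
    ∃ y z O', O = y ::ₘ z ::ₘ O' ∧ f y = f z := by
  induction O using Multiset.induction_on with
  | empty => simp at h
  | cons x O ih =>
    by_cases hO : (O.map f).Nodup
    · rw [Multiset.map_cons, Multiset.nodup_cons] at h
      have : f x ∈ O.map f := by
        by_contra hx
        exact h ⟨hx, hO⟩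
      obtain ⟨z, hz, hzx⟩ := Multiset.mem_map.1 this
      obtain ⟨O', rfl⟩ := Multiset.exists_cons_of_mem hz
      exact ⟨x, z, O', rfl, hzx.symm⟩
    · obtain ⟨y, z, O', rfl, hf⟩ := ih hO
      exact ⟨y, z, x ::ₘ O', by rw [Multiset.cons_swap x y, Multiset.cons_swap x z], hf⟩

theorem dup_of_card {α β : Type*} (f : α → β) (O : Multiset α) (X : Set β) (hX : X.Finite)
    (hf : ∀ x ∈ O, f x ∈ X) (h : X.ncard < O.card) :
    ∃ y z O', O = y ::ₘ z ::ₘ O' ∧ f y = f z := by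
  apply dup
  intro hn
  have h1 : ((⟨O.map f, hn⟩ : Finset β) : Set β).ncard ≤ X.ncard := by
    apply Set.ncard_le_ncard _ hX
    intro x hx
    simp at hx
    obtain ⟨y, hy, rfl⟩ := hx
    exact hf y hy
  rw [Set.ncard_coe_finset] at h1
  simp at h1
  omega

theorem subs_prime {ι : Type*} {p : ℕ} [Fact p.Prime] (f : ι → ZMod p) (B : Multiset ι)
    (hf : ∀ b ∈ B, f b ≠ 0) (hB : B.card < p) : B.card + 1 ≤ (subs f B).ncard := by
  induction B using Multiset.induction_on with
  | empty =>
    rw [Multiset.card_zero, Nat.succ_le_iff, Set.ncard_pos]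
    exact ⟨0, zero_mem_subs _ _⟩
  | cons b B ih =>
    rw [Multiset.card_cons] at hB ⊢
    have ih := ih (fun x hx => hf x (by simp [hx])) (by omega)
    have hsub : subs f B ⊆ subs f (b ::ₘ B) := subs_mono f (Multiset.le_cons_self _ _)
    by_cases heq : subs f B = subs f (b ::ₘ B)
    · have hst : f b ∈ stab (subs f B) := by
        apply mem_stab_of
        intro y hy
        rw [heq, ← Multiset.singleton_add, mem_subs_add]
        exact ⟨f b, (mem_subs_singleton _ _).2 (Or.inr rfl), y, hy, rfl⟩
      have huniv : subs f B = Set.univ := by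
        rw [Set.eq_univ_iff_forall]
        intro x
        have h1 : (x * (f b)⁻¹).val • f b ∈ stab (subs f B) := AddSubgroup.nsmul_mem _ hst _
        have h2 : (x * (f b)⁻¹).val • f b = x := by
          rw [nsmul_eq_mul, ZMod.natCast_zmod_val, mul_assoc,
            inv_mul_cancel₀ (hf b (by simp)), mul_one]
        rw [h2] at h1
        have := (h1 0).2 (zero_mem_subs _ _)
        simpa using this
      rw [← heq, huniv, Set.ncard_univ, Nat.card_zmod]
      omega
    · have := Set.ncard_lt_ncard (HasSubset.Subset.ssubset_of_ne hsub heq) (Set.toFinite _)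
      omega

namespace Dat
variable {G : Type*} [Group G] {n : ℕ} (d : Dat G n)

theorem extract [DecidableEq G] (N : AddSubgroup (ZMod n)) (c s : ℕ) (β : ℕ) (R : Multiset G)
    (h1 : ∀ R' ≤ R, c + s ≤ R'.card → ∃ u : List G, u ≠ [] ∧ (u : Multiset G) ≤ R' ∧
      u.length ≤ s ∧ d.inn u.prod ∧ d.val u ∈ N)
    (h2 : ∀ R' ≤ R, c ≤ R'.card → ∃ u : List G, u ≠ [] ∧ (u : Multiset G) ≤ R' ∧
      d.inn u.prod ∧ d.val u ∈ N)
    (h : s * β + c ≤ R.card) :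
    ∃ B : Multiset (List G), B.card = β + 1 ∧ flat B ≤ R ∧
      ∀ u ∈ B, u ≠ [] ∧ d.inn u.prod ∧ d.val u ∈ N := by
  induction β generalizing R with
  | zero =>
    obtain ⟨u, h3, h4, h5, h6⟩ := h2 R le_rfl (by omega)
    refine ⟨{u}, by simp, by simpa [flat] using h4, ?_⟩
    intro v hv
    rw [Multiset.mem_singleton.1 hv]
    exact ⟨h3, h5, h6⟩
  | succ β ih =>
    obtain ⟨u, h3, h4, h7, h5, h6⟩ := h1 R le_rfl (by
      have : s * 1 ≤ s * (β + 1) := Nat.mul_le_mul le_rfl (by omega)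
      omega)
    have hle : R - (u : Multiset G) ≤ R := tsub_le_self
    obtain ⟨B, hB1, hB2, hB3⟩ := ih (R - (u : Multiset G))
      (fun R' hR' => h1 R' (hR'.trans hle)) (fun R' hR' => h2 R' (hR'.trans hle)) (by
        rw [Multiset.card_sub h4, Multiset.coe_card]
        rw [mul_add] at h
        omega)
    refine ⟨u ::ₘ B, by simp [hB1], ?_, ?_⟩
    · rw [flat_cons, add_comm]
      exact (le_tsub_iff_right h4).1 hB2
    · intro v hv
      rcases Multiset.mem_cons.1 hv with rfl | hv
      · exact ⟨h3, h5, h6⟩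
      · exact hB3 v hv

theorem blocks_one [NeZero n] (N : AddSubgroup (ZMod n)) (B : Multiset (List G))
    (hB : ∀ u ∈ B, u ≠ [] ∧ d.inn u.prod ∧ d.val u ∈ N) (h : Nat.card N ≤ B.card) :
    ∃ U ≤ flat B, U ≠ 0 ∧ IsProductOne U := by
  obtain ⟨U, h1, h2, h3⟩ := zeroSum N d.val B (fun u hu => (hB u hu).2.2) h
  refine ⟨flat U, flat_le h1, ?_, ?_⟩
  · exact flat_ne (fun u hu => (hB u (Multiset.mem_of_le h1 hu)).1) h2
  · exact d.flat_one U (fun u hu => (hB u (Multiset.mem_of_le h1 hu)).2.1) h3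

/-- coordinate of an outer element -/
noncomputable def xo (g : G) : ZMod n := d.lam (g * d.t⁻¹)

theorem a_xo {g : G} (hg : ¬ d.inn g) : d.a (d.xo g) * d.t = g := by
  rw [xo, d.a_lam (d.inn_out hg (d.inv_not d.t_not))]; simp

theorem lam_out {y z : G} (hy : ¬ d.inn y) (hz : ¬ d.inn z) :
    d.lam (y * z) = d.xo y + d.r * d.xo z + d.lam (d.t * d.t) := by
  apply d.a_inj
  rw [d.a_lam (d.inn_out hy hz), d.a_add, d.a_add, d.a_lam (d.inn_out d.t_not d.t_not)]
  conv_lhs => rw [← d.a_xo hy, ← d.a_xo hz]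
  rw [mul_assoc, ← mul_assoc d.t, d.conj' d.t_not]
  simp [mul_assoc]

theorem lam_list (l : List G) (hl : ∀ g ∈ l, d.inn g) :
    d.inn l.prod ∧ d.lam l.prod = (l.map d.lam).sum := by
  induction l with
  | nil => exact ⟨by simpa using d.inn_one, by
      have := d.lam_a 0; rw [d.a_zero] at this; simpa using this⟩
  | cons g l ih =>
    have h1 := ih (fun x hx => hl x (by simp [hx]))
    have h2 := hl g (by simp)
    rw [List.prod_cons]
    exact ⟨d.inn_mul h2 h1.1, by rw [d.lam_mul h2 h1.1, h1.2]; simp⟩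

theorem lam_toList (T : Multiset G) (hl : ∀ g ∈ T, d.inn g) :
    d.inn T.toList.prod ∧ d.lam T.toList.prod = (T.map d.lam).sum := by
  have := d.lam_list T.toList (by simpa using hl)
  refine ⟨this.1, this.2.trans ?_⟩
  rw [← Multiset.sum_coe, ← Multiset.map_coe, Multiset.coe_toList]

end Dat
end DavAux

namespace DavAux

theorem nt {n : ℕ} [NeZero n] (R s : ℕ) (hR : 2 ∣ n → ¬ 2 ∣ R) (hs : 2 ∣ n → ¬ 2 ∣ s)
    (hp : ∀ p, p.Prime → p ≠ 2 → p ∣ n → ¬ p ∣ R + 1) :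
    ∃ x : ℕ, Nat.Coprime ((1 + R) * x + s) n := by
  obtain ⟨e, n', hn', hn⟩ := Nat.exists_eq_two_pow_mul_odd (NeZero.ne n)
  have hdvd : n' ∣ n := by rw [hn]; exact Dvd.intro_left _ rfl
  have : NeZero n' := ⟨by rintro rfl; simp at hn'⟩
  have hc : Nat.Coprime (R + 1) n' := by
    apply Nat.Coprime.symm
    rw [Nat.coprime_iff_gcd_eq_one]
    by_contra hne
    obtain ⟨p, hpp, hpd⟩ := Nat.exists_prime_and_dvd hne
    have h1 := hpd.trans (Nat.gcd_dvd_left _ _)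
    refine hp p hpp ?_ (h1.trans hdvd) (hpd.trans (Nat.gcd_dvd_right _ _))
    rintro rfl
    exact (Nat.not_even_iff_odd.2 hn') (even_iff_two_dvd.2 h1)
  let x : ZMod n' := (1 - s) * ((ZMod.unitOfCoprime _ hc)⁻¹ : (ZMod n')ˣ)
  have hx : (((1 + R) * x.val + s : ℕ) : ZMod n') = 1 := by
    push_cast
    rw [ZMod.natCast_zmod_val]
    have h1 : ((R : ZMod n') + 1) * (((ZMod.unitOfCoprime _ hc)⁻¹ : (ZMod n')ˣ) : ZMod n') = 1 := by
      have := (ZMod.unitOfCoprime _ hc).mul_inv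
      rw [ZMod.coe_unitOfCoprime] at this
      push_cast at this
      exact this
    simp only [x]
    linear_combination (1 - s) * h1
  refine ⟨x.val, ?_⟩
  rw [Nat.coprime_iff_gcd_eq_one]
  by_contra hne
  obtain ⟨p, hpp, hpd⟩ := Nat.exists_prime_and_dvd hne
  have h1 := hpd.trans (Nat.gcd_dvd_left _ _)
  have h2 := hpd.trans (Nat.gcd_dvd_right _ _)
  by_cases h2p : p = 2
  · subst h2p
    have := hR h2
    have h4 := hs h2
    have h5 : 2 ∣ (1 + R) * x.val := Dvd.dvd.mul_right (by omega) _
    omega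
  · have h3 : p ∣ n' := by
      rw [hn] at h2
      rcases hpp.dvd_mul.1 h2 with h | h
      · exact absurd ((Nat.prime_dvd_prime_iff_eq hpp Nat.prime_two).1 (hpp.dvd_of_dvd_pow h)) h2p
      · exact h
    have h4 : (((1 + R) * x.val + s : ℕ) : ZMod p) = 1 := by
      have := congrArg (ZMod.castHom h3 (ZMod p)) hx
      simpa only [map_natCast, map_one] using this
    rw [(ZMod.natCast_eq_zero_iff _ _).2 h1] at h4
    have := Fact.mk hpp
    exact zero_ne_one h4

namespace Dat
variable {G : Type*} [Group G] {n : ℕ} (d : Dat G n)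

theorem a_nsmul (k : ℕ) (x : ZMod n) : d.a (k • x) = d.a x ^ k := by
  induction k with
  | zero => simp [d.a_zero]
  | succ k ih => rw [succ_nsmul, d.a_add, ih, pow_succ]

theorem cyclic_of_unit [NeZero n] {y : G} (hy : ¬ d.inn y) (hu : IsUnit (d.lam (y * y))) :
    IsCyclic G := by
  have hin : ∀ x, d.a x ∈ Subgroup.zpowers y := by
    intro x
    obtain ⟨u, hu⟩ := hu
    have h1 : (x * (u⁻¹ : (ZMod n)ˣ)).val • d.lam (y * y) = x := by
      rw [nsmul_eq_mul, ZMod.natCast_zmod_val, ← hu, mul_assoc, Units.inv_mul, mul_one]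
    rw [← h1, d.a_nsmul, d.a_lam (d.inn_out hy hy)]
    exact Subgroup.pow_mem _ (Subgroup.mul_mem _ (Subgroup.mem_zpowers y) (Subgroup.mem_zpowers y)) _
  refine ⟨y, fun g => ?_⟩
  by_cases hg : d.inn g
  · rw [← d.a_lam hg]; exact hin _
  · have h1 := d.a_lam (d.inn_out hg (d.inv_not hy))
    have h2 := hin (d.lam (g * y⁻¹))
    rw [h1] at h2
    have h3 := Subgroup.mul_mem _ h2 (Subgroup.mem_zpowers y)
    rwa [inv_mul_cancel_right] at h3

theorem out_a {y : G} (hy : ¬ d.inn y) (x : ZMod n) : ¬ d.inn (d.a x * y) :=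
  fun h => hy ((d.inn_mul_iff_left (d.inn_a x)).1 h)

theorem xo_a (x : ZMod n) : d.xo (d.a x * d.t) = x := by
  rw [xo, mul_assoc, mul_inv_cancel, mul_one, d.lam_a]

theorem dich [NeZero n] (hG : ¬ IsCyclic G) :
    (∃ p, p.Prime ∧ p ≠ 2 ∧ ∃ h : p ∣ n, ZMod.castHom h (ZMod p) d.r = -1) ∨
    (∃ h : 2 ∣ n, ZMod.castHom h (ZMod 2) (d.lam (d.t * d.t)) = 0) := by
  by_contra hcon
  push Not at hcon
  obtain ⟨h1, h2⟩ := hcon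
  have cast : ∀ (p : ℕ) (h : p ∣ n) (x : ZMod n), ZMod.castHom h (ZMod p) x = (x.val : ZMod p) := by
    intro p h x
    conv_lhs => rw [← ZMod.natCast_zmod_val x]
    rw [map_natCast]
  obtain ⟨x, hx⟩ := nt (n := n) d.r.val (d.lam (d.t * d.t)).val (by
      intro h hd
      have h3 := congrArg (ZMod.castHom h (ZMod 2)) d.r_sq
      rw [map_mul, cast, (ZMod.natCast_eq_zero_iff _ _).2 hd, map_one] at h3
      simp at h3) (by
      intro h hd
      apply h2 h
      rw [cast, ZMod.natCast_eq_zero_iff]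
      exact hd) (by
      intro p hp hp2 hpn hd
      apply h1 p hp hp2 hpn
      rw [cast, eq_neg_iff_add_eq_zero]
      rw [← ZMod.natCast_eq_zero_iff] at hd
      exact_mod_cast hd)
  apply hG
  refine d.cyclic_of_unit (d.out_a d.t_not (x : ZMod n)) ?_
  rw [d.lam_out (d.out_a d.t_not _) (d.out_a d.t_not _), d.xo_a]
  have := (ZMod.unitOfCoprime _ hx).isUnit
  rw [ZMod.coe_unitOfCoprime] at this
  push_cast at this
  simp only [ZMod.natCast_zmod_val] at this
  convert this using 1
  ring

theorem card_ker {p : ℕ} [NeZero n] (h : p ∣ n) :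
    Nat.card (ZMod.castHom h (ZMod p)).toAddMonoidHom.ker * p = n := by
  have h1 := (ZMod.castHom h (ZMod p)).toAddMonoidHom.ker.card_mul_index
  rw [AddSubgroup.index_ker] at h1
  have h2 : (ZMod.castHom h (ZMod p)).toAddMonoidHom.range = ⊤ := by
    rw [AddMonoidHom.range_eq_top]
    exact ZMod.castHom_surjective h
  rw [h2, AddSubgroup.card_top, Nat.card_zmod, Nat.card_zmod] at h1
  exact h1

end Dat
end DavAux

namespace DavAux
namespace Dat
variable {G : Type*} [Group G] {n : ℕ} (d : Dat G n)

theorem split_io (R : Multiset G) : ∃ I O : Multiset G, R = I + O ∧ (∀ g ∈ I, d.inn g) ∧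
    ∀ g ∈ O, ¬ d.inn g := by
  classical
  refine ⟨R.filter d.inn, R.filter (fun g => ¬ d.inn g), (Multiset.filter_add_not _ _).symm, ?_, ?_⟩
  · intro g hg; exact (Multiset.mem_filter.1 hg).2
  · intro g hg; exact (Multiset.mem_filter.1 hg).2

theorem blkI {I O T : Multiset G} (hI : ∀ g ∈ I, d.inn g) (hT : T ≤ I) (h0 : T ≠ 0) :
    T.toList ≠ [] ∧ (T.toList : Multiset G) ≤ I + O ∧ T.toList.length = T.card ∧
      d.inn T.toList.prod ∧ d.val T.toList = (T.map d.lam).sum := by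
  have h1 := d.lam_toList T (fun g hg => hI g (Multiset.mem_of_le hT hg))
  refine ⟨by simpa using h0, ?_, by simp, h1.1, h1.2⟩
  rw [Multiset.coe_toList]
  exact hT.trans (Multiset.le_add_right _ _)

theorem blkO {I O T : Multiset G} (hI : ∀ g ∈ I, d.inn g) (hT : T ≤ I) {y z : G}
    (hO : ∀ g ∈ O, ¬ d.inn g) (h : {y, z} ≤ O) :
    T.toList ++ [y, z] ≠ [] ∧ ((T.toList ++ [y, z] : List G) : Multiset G) ≤ I + O ∧
      (T.toList ++ [y, z]).length = T.card + 2 ∧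
      d.inn (T.toList ++ [y, z]).prod ∧ d.val (T.toList ++ [y, z]) =
        (T.map d.lam).sum + (d.xo y + d.r * d.xo z + d.lam (d.t * d.t)) := by
  have h1 := d.lam_toList T (fun g hg => hI g (Multiset.mem_of_le hT hg))
  have hy := hO y (Multiset.mem_of_le h (by simp))
  have hz := hO z (Multiset.mem_of_le h (by simp))
  have h2 := d.inn_out hy hz
  refine ⟨by simp, ?_, by simp, ?_, ?_⟩
  · rw [← Multiset.coe_add, Multiset.coe_toList]
    exact add_le_add hT h
  · rw [List.prod_append]
    exact d.inn_mul h1.1 (by simpa using h2)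
  · rw [val, List.prod_append, List.prod_cons, List.prod_cons, List.prod_nil, mul_one,
      d.lam_mul h1.1 h2, h1.2, d.lam_out hy hz]

theorem meet {p : ℕ} [NeZero p] (X Y : Set (ZMod p)) (h : p < X.ncard + Y.ncard) :
    ∃ x, x ∈ X ∧ x ∈ Y := by
  by_contra hc
  push Not at hc
  have hd : Disjoint X Y := Set.disjoint_left.2 hc
  have h1 := Set.ncard_union_eq hd (Set.toFinite _) (Set.toFinite _)
  have h2 := Set.ncard_le_ncard (Set.subset_univ (X ∪ Y)) (Set.toFinite _)
  rw [Set.ncard_univ, Nat.card_zmod] at h2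
  omega

theorem block_odd [NeZero n] {p : ℕ} (hp : p.Prime) (hp2 : p ≠ 2) (h : p ∣ n)
    (hr : ZMod.castHom h (ZMod p) d.r = -1) (R : Multiset G) (hR : R.card = p + 1) :
    ∃ u : List G, u ≠ [] ∧ (u : Multiset G) ≤ R ∧ u.length ≤ p ∧ d.inn u.prod ∧
      d.val u ∈ (ZMod.castHom h (ZMod p)).toAddMonoidHom.ker := by
  have := Fact.mk hp
  have hp3 : 3 ≤ p := by have := hp.two_le; omega
  set φ := ZMod.castHom h (ZMod p) with hφ
  have h2 : (2 : ZMod p) ≠ 0 := by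
    intro h0
    have : ((2 : ℕ) : ZMod p) = 0 := by exact_mod_cast h0
    rw [ZMod.natCast_eq_zero_iff] at this
    have := Nat.le_of_dvd (by norm_num) this
    omega
  have hs : φ (d.lam (d.t * d.t)) = 0 := by
    have := congrArg φ (d.lam_sq d.t_not)
    rw [map_mul, map_sub, hr, map_one, map_zero] at this
    have h3 : (2 : ZMod p) * φ (d.lam (d.t * d.t)) = 0 := by linear_combination -this
    exact (mul_eq_zero.1 h3).resolve_left h2
  have hker : ∀ x, x ∈ φ.toAddMonoidHom.ker ↔ φ x = 0 := fun x => Iff.rfl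
  obtain ⟨I, O, rfl, hI, hO⟩ := d.split_io R
  let f : G → ZMod p := fun g => φ (d.lam g)
  have hsum : ∀ T : Multiset G, φ (T.map d.lam).sum = (T.map f).sum := by
    intro T
    rw [map_multiset_sum, Multiset.map_map]; rfl
  let x : G → ZMod p := fun g => φ (d.xo g)
  rw [Multiset.card_add] at hR
  by_contra hcon
  push Not at hcon
  -- inner blocks
  have k1 : ∀ T ≤ I, T ≠ 0 → T.card ≤ p → (T.map f).sum ≠ 0 := by
    intro T hT h0 hc h3
    obtain ⟨e1, e2, e3, e4, e5⟩ := d.blkI (O := O) hI hT h0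
    refine hcon _ e1 e2 (e3.trans_le hc) e4 ?_
    rw [hker, e5, hsum, h3]
  have k2 : ∀ T ≤ I, ∀ y z, {y, z} ≤ O → T.card + 2 ≤ p → (T.map f).sum ≠ x z - x y := by
    intro T hT y z hyz hc h3
    obtain ⟨e1, e2, e3, e4, e5⟩ := d.blkO hI hT hO hyz
    refine hcon _ e1 e2 (e3.trans_le hc) e4 ?_
    rw [hker, e5, map_add, hsum, h3, map_add, map_add, map_mul, hr, hs]
    simp only [x]; ring
  have hIc : I.card < p := by
    by_contra hc
    obtain ⟨I', hI', hc'⟩ := exists_le_card I (not_lt.1 hc)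
    obtain ⟨T, hT, h0, h3⟩ := zeroSum (⊤ : AddSubgroup (ZMod p)) f I' (by simp)
      (by rw [AddSubgroup.card_top, Nat.card_zmod]; omega)
    exact k1 T (hT.trans hI') h0 (hc' ▸ Multiset.card_le_card hT) h3
  have hf : ∀ b ∈ I, f b ≠ 0 := by
    intro b hb
    have := k1 {b} (Multiset.singleton_le.2 hb) (by simp) (by simp; omega)
    simpa using this
  have hnd : (O.map x).Nodup := by
    by_contra hd
    obtain ⟨y, z, O', rfl, he⟩ := dup x O hd
    refine k2 0 (Multiset.zero_le _) y z ?_ (by simp; omega) ?_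
    · change y ::ₘ z ::ₘ 0 ≤ _
      simp
    · simp [he]
  by_cases hO3 : 3 ≤ O.card
  · obtain ⟨y0, hy0⟩ := Multiset.card_pos_iff_exists_mem.1 (show 0 < O.card by omega)
    obtain ⟨O', rfl⟩ := Multiset.exists_cons_of_mem hy0
    rw [Multiset.map_cons, Multiset.nodup_cons] at hnd
    let D : Finset (ZMod p) := ⟨O'.map (fun y => x y - x y0), by
      have := hnd.2.map (f := fun v => v - x y0) (sub_left_injective)
      rw [Multiset.map_map] at this
      exact this⟩
    have hD : (D : Set (ZMod p)).ncard = O'.card := by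
      rw [Set.ncard_coe_finset]; simp [D]
    have h5 := subs_prime f I hf hIc
    rw [Multiset.card_cons] at hR hO3
    obtain ⟨v, ⟨T, hT, rfl⟩, hv2⟩ := meet (subs f I) D (by omega)
    have hv3 : (T.map f).sum ∈ O'.map (fun y => x y - x y0) := hv2
    obtain ⟨y, hy, hy2⟩ := Multiset.mem_map.1 hv3
    refine k2 T hT y0 y ?_ ?_ hy2.symm
    · change y0 ::ₘ {y} ≤ _
      rw [Multiset.cons_le_cons_iff]
      simpa using hy
    · have := Multiset.card_le_card hT
      omega
  · have hO2 : O.card = 2 := by omega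
    obtain ⟨y, z, rfl⟩ := Multiset.card_eq_two.1 hO2
    have hyz : x y ≠ x z := by simpa using hnd
    obtain ⟨g, hg⟩ := Multiset.card_pos_iff_exists_mem.1 (show 0 < I.card by omega)
    obtain ⟨I', rfl⟩ := Multiset.exists_cons_of_mem hg
    rw [Multiset.card_cons] at hIc hR
    have h5 := subs_prime f I' (fun b hb => hf b (by simp [hb])) (by omega)
    have hne : x z - x y ≠ x y - x z := by
      intro he
      have : 2 * (x z - x y) = 0 := by linear_combination he
      rcases mul_eq_zero.1 this with h | h
      · exact h2 h
      · exact hyz (sub_eq_zero.1 h).symm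
    have h6 : ({x z - x y, x y - x z} : Set (ZMod p)).ncard = 2 := Set.ncard_pair hne
    obtain ⟨v, ⟨T, hT, rfl⟩, hv2⟩ := meet (subs f I') {x z - x y, x y - x z} (by omega)
    have hT2 := hT.trans (Multiset.le_cons_self I' g)
    have hTc := Multiset.card_le_card hT
    rcases hv2 with hv | hv
    · exact k2 T hT2 y z le_rfl (by omega) hv
    · exact k2 T hT2 z y (by rw [Multiset.pair_comm]) (by omega) hv

theorem two_cases (v : ZMod 2) : v = 0 ∨ v = 1 := by revert v; decide

theorem block_two [NeZero n] (h : 2 ∣ n) (hs : ZMod.castHom h (ZMod 2) (d.lam (d.t * d.t)) = 0)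
    (R : Multiset G) :
    (5 ≤ R.card → ∃ u : List G, u ≠ [] ∧ (u : Multiset G) ≤ R ∧ u.length ≤ 2 ∧ d.inn u.prod ∧
      d.val u ∈ (ZMod.castHom h (ZMod 2)).toAddMonoidHom.ker) ∧
    (3 ≤ R.card → ∃ u : List G, u ≠ [] ∧ (u : Multiset G) ≤ R ∧ d.inn u.prod ∧
      d.val u ∈ (ZMod.castHom h (ZMod 2)).toAddMonoidHom.ker) := by
  set φ := ZMod.castHom h (ZMod 2) with hφ
  have hr : φ d.r = 1 := by
    have := congrArg φ d.r_sq
    rw [map_mul, map_one] at this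
    rcases two_cases (φ d.r) with h | h
    · rw [h] at this; simp at this
    · exact h
  have hker : ∀ x, x ∈ φ.toAddMonoidHom.ker ↔ φ x = 0 := fun x => Iff.rfl
  obtain ⟨I, O, rfl, hI, hO⟩ := d.split_io R
  let f : G → ZMod 2 := fun g => φ (d.lam g)
  have hsum : ∀ T : Multiset G, φ (T.map d.lam).sum = (T.map f).sum := by
    intro T
    rw [map_multiset_sum, Multiset.map_map]; rfl
  let x : G → ZMod 2 := fun g => φ (d.xo g)
  have k1 : ∀ k, k ≤ I.card → 2 ≤ k → ∃ u : List G, u ≠ [] ∧ (u : Multiset G) ≤ I + O ∧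
      u.length ≤ k ∧ d.inn u.prod ∧ d.val u ∈ φ.toAddMonoidHom.ker := by
    intro k hk hk2
    obtain ⟨I', hI', hc'⟩ := exists_le_card I hk
    obtain ⟨T, hT, h0, h3⟩ := zeroSum (⊤ : AddSubgroup (ZMod 2)) f I' (by simp)
      (by rw [AddSubgroup.card_top, Nat.card_zmod]; omega)
    obtain ⟨e1, e2, e3, e4, e5⟩ := d.blkI (O := O) hI (hT.trans hI') h0
    refine ⟨_, e1, e2, ?_, e4, ?_⟩
    · rw [e3, ← hc']; exact Multiset.card_le_card hT
    · rw [hker, e5, hsum, h3]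
  have k2 : ∀ T ≤ I, ∀ y z, {y, z} ≤ O → (T.map f).sum + x y + x z = 0 →
      ∃ u : List G, u ≠ [] ∧ (u : Multiset G) ≤ I + O ∧
      u.length ≤ T.card + 2 ∧ d.inn u.prod ∧ d.val u ∈ φ.toAddMonoidHom.ker := by
    intro T hT y z hyz h3
    obtain ⟨e1, e2, e3, e4, e5⟩ := d.blkO hI hT hO hyz
    refine ⟨_, e1, e2, e3.le, e4, ?_⟩
    rw [hker, e5, map_add, hsum, map_add, map_add, map_mul, hr, hs]
    linear_combination h3
  have k3 : 3 ≤ O.card → ∃ u : List G, u ≠ [] ∧ (u : Multiset G) ≤ I + O ∧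
      u.length ≤ 2 ∧ d.inn u.prod ∧ d.val u ∈ φ.toAddMonoidHom.ker := by
    intro hc
    obtain ⟨y, z, O', rfl, he⟩ := dup_of_card x O Set.univ (Set.toFinite _) (by simp)
      (by rw [Set.ncard_univ, Nat.card_zmod]; omega)
    refine k2 0 (Multiset.zero_le _) y z ?_ ?_
    · change y ::ₘ z ::ₘ 0 ≤ _
      simp
    · simp only [Multiset.map_zero, Multiset.sum_zero, zero_add, he]
      rcases two_cases (x z) with h | h <;> rw [h] <;> rfl
  rw [Multiset.card_add]
  constructor
  · intro hc
    by_cases hI2 : 2 ≤ I.card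
    · exact k1 2 hI2 le_rfl
    · exact k3 (by omega)
  · intro hc
    by_cases hI2 : 2 ≤ I.card
    · obtain ⟨u, h1, h2, h3, h4⟩ := k1 2 hI2 le_rfl
      exact ⟨u, h1, h2, h4⟩
    by_cases hO3 : 3 ≤ O.card
    · obtain ⟨u, h1, h2, h3, h4⟩ := k3 hO3
      exact ⟨u, h1, h2, h4⟩
    obtain ⟨y, z, rfl⟩ := Multiset.card_eq_two.1 (show O.card = 2 by omega)
    obtain ⟨g, rfl⟩ := Multiset.card_eq_one.1 (show I.card = 1 by omega)
    by_cases hg : f g = 0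
    · obtain ⟨e1, e2, e3, e4, e5⟩ := d.blkI (O := {y, z}) hI (le_refl {g}) (by simp)
      exact ⟨_, e1, e2, e4, by rw [hker, e5, hsum]; simpa using hg⟩
    · have hg1 := (two_cases (f g)).resolve_left hg
      have : ∃ T ≤ ({g} : Multiset G), (T.map f).sum + x y + x z = 0 := by
        rcases two_cases (x y) with h | h <;> rcases two_cases (x z) with h' | h'
        · exact ⟨0, Multiset.zero_le _, by rw [h, h']; rfl⟩
        · exact ⟨{g}, le_rfl, by rw [h, h', Multiset.map_singleton, Multiset.sum_singleton, hg1]; rfl⟩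
        · exact ⟨{g}, le_rfl, by rw [h, h', Multiset.map_singleton, Multiset.sum_singleton, hg1]; rfl⟩
        · exact ⟨0, Multiset.zero_le _, by rw [h, h']; rfl⟩
      obtain ⟨T, hT, hT2⟩ := this
      obtain ⟨u, h1, h2, h3, h4⟩ := k2 T hT y z le_rfl hT2
      exact ⟨u, h1, h2, h4⟩

theorem d_le {G : Type*} [Group G] {n : ℕ} (d : Dat G n) [NeZero n] (hG : ¬ IsCyclic G) (S : Multiset G) (hS : n + 1 ≤ S.card) :
    ∃ U ≤ S, U ≠ 0 ∧ IsProductOne U := by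
  classical
  rcases d.dich hG with ⟨p, hp, hp2, h, hr⟩ | ⟨h, hs⟩
  · have hk := card_ker (n := n) h
    have hk0 : 0 < Nat.card (ZMod.castHom h (ZMod p)).toAddMonoidHom.ker := Nat.card_pos
    set N := (ZMod.castHom h (ZMod p)).toAddMonoidHom.ker with hN
    have key : ∀ R' : Multiset G, p + 1 ≤ R'.card → ∃ u : List G, u ≠ [] ∧ (u : Multiset G) ≤ R' ∧
      u.length ≤ p ∧ d.inn u.prod ∧ d.val u ∈ N := by
      intro R' hR'
      obtain ⟨R'', h1, h2⟩ := exists_le_card R' hR'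
      obtain ⟨u, h3, h4, h5⟩ := d.block_odd hp hp2 h hr R'' h2
      exact ⟨u, h3, h4.trans h1, h5⟩
    obtain ⟨B, h1, h2, h3⟩ := d.extract N (p + 1) p (Nat.card N - 1) S
      (fun R' _ hc => key R' (by omega))
      (fun R' _ hc => by obtain ⟨u, h1, h2, h3, h4⟩ := key R' hc; exact ⟨u, h1, h2, h4⟩)
      (by
        obtain ⟨k, hk'⟩ := Nat.exists_eq_add_of_lt hk0
        rw [hk'] at hk ⊢
        simp only [zero_add, Nat.add_sub_cancel] at hk ⊢
        nlinarith)
    obtain ⟨U, h4, h5⟩ := d.blocks_one N B h3 (by omega)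
    exact ⟨U, h4.trans h2, h5⟩
  · have hk := card_ker (n := n) h
    have hk0 : 0 < Nat.card (ZMod.castHom h (ZMod 2)).toAddMonoidHom.ker := Nat.card_pos
    set N := (ZMod.castHom h (ZMod 2)).toAddMonoidHom.ker with hN
    obtain ⟨B, h1, h2, h3⟩ := d.extract N 3 2 (Nat.card N - 1) S
      (fun R' _ hc => (d.block_two h hs R').1 hc)
      (fun R' _ hc => (d.block_two h hs R').2 hc)
      (by omega)
    obtain ⟨U, h4, h5⟩ := d.blocks_one N B h3 (by omega)
    exact ⟨U, h4.trans h2, h5⟩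

end Dat
end DavAux

namespace DavAux
namespace Dat
variable {G : Type*} [Group G] {n : ℕ} (d : Dat G n)
open scoped commutatorElement

/-- the commutator subgroup, explicitly -/
def Q : Subgroup G where
  carrier := {g | ∃ x, d.a (d.del x) = g}
  mul_mem' := by
    rintro _ _ ⟨x, rfl⟩ ⟨y, rfl⟩
    exact ⟨x + y, by rw [map_add, d.a_add]⟩
  one_mem' := ⟨0, by rw [map_zero, d.a_zero]⟩
  inv_mem' := by
    rintro _ ⟨x, rfl⟩
    exact ⟨-x, by rw [map_neg, d.a_neg]⟩

theorem mem_Q {g : G} : g ∈ d.Q ↔ ∃ x, d.a (d.del x) = g := Iff.rfl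

theorem comm_in_out (x : ZMod n) {y : G} (hy : ¬ d.inn y) : ⁅y, d.a x⁆ = d.a (d.del x) := by
  rw [commutatorElement_def, d.conj' hy, d.del_apply, sub_mul, one_mul, sub_eq_add_neg, d.a_add,
    d.a_neg]
  group

theorem comm_eq : commutator G = d.Q := by
  apply le_antisymm
  · rw [commutator_def, Subgroup.commutator_le]
    intro g _ h _
    by_cases hg : d.inn g <;> by_cases hh : d.inn h
    · obtain ⟨x, rfl⟩ := hg
      obtain ⟨y, rfl⟩ := hh
      have : ⁅d.a x, d.a y⁆ = 1 := by
        rw [commutatorElement_eq_one_iff_mul_comm, ← d.a_add, ← d.a_add, add_comm]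
      rw [this]; exact one_mem _
    · obtain ⟨x, rfl⟩ := hg
      rw [← commutatorElement_inv, d.comm_in_out x hh]
      exact inv_mem ⟨x, rfl⟩
    · obtain ⟨x, rfl⟩ := hh
      rw [d.comm_in_out x hg]
      exact ⟨x, rfl⟩
    · refine ⟨-d.lam (g * h), ?_⟩
      have h1 := d.a_lam (d.inn_out hg hh)
      have h2 := d.a_lam (d.inn_out hh hg)
      have h3 := d.lam_swap hg hh
      have : ⁅g, h⁆ = g * h * (h * g)⁻¹ := by rw [commutatorElement_def]; group
      rw [this, ← h1, ← h2, ← d.a_neg, ← d.a_add, h1, h3, d.del_apply]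
      congr 1; ring
  · rintro _ ⟨x, rfl⟩
    rw [← d.comm_in_out x d.t_not, commutator_def]
    exact Subgroup.commutator_mem_commutator (Subgroup.mem_top _) (Subgroup.mem_top _)

theorem card_comm : Nat.card (commutator G) = Nat.card d.del.range := by
  rw [d.comm_eq]
  symm
  refine Nat.card_congr (Equiv.ofBijective
    (fun x : d.del.range => (⟨d.a x, ?_⟩ : d.Q)) ⟨?_, ?_⟩)
  · obtain ⟨_, y, rfl⟩ := x
    exact ⟨y, rfl⟩
  · intro x y h
    exact Subtype.ext (d.a_inj (congrArg Subtype.val h))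
  · rintro ⟨_, y, rfl⟩
    exact ⟨⟨d.del y, y, rfl⟩, rfl⟩

theorem card_ker_range [NeZero n] : Nat.card d.del.ker * Nat.card d.del.range = n := by
  have h1 := d.del.ker.card_mul_index
  rw [AddSubgroup.index_ker, Nat.card_zmod] at h1
  exact h1

theorem absorb {T : Multiset (List G)} (hT : ∀ u ∈ T, d.IsUnit' u) {p : List G} (hp : p ∈ T)
    (hpp : d.IsPair p) (hfull : ∀ x, d.del x ∈ subs d.dv T) {R U : Multiset G}
    (hS : IsProductOne (flat T + R + U)) (hU : IsProductOne U) : IsProductOne (flat T + R) := by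
  have h1 := prodOne_abel (Abelianization.of : G →* Abelianization G) hS
  have h2 := prodOne_abel (Abelianization.of : G →* Abelianization G) hU
  rw [Multiset.map_add, Multiset.prod_add, h2, mul_one, Multiset.map_add, Multiset.prod_add] at h1
  obtain ⟨l, hl, hl2⟩ := d.flat_prod T (fun u hu => d.unit_inn (hT u hu))
  have h3 : Abelianization.of (l.prod * R.toList.prod) = 1 := by
    rw [← h1, map_mul, ← hl, map_list_prod, map_list_prod, Multiset.map_coe, Multiset.prod_coe]
    congr 1
    rw [← Multiset.prod_coe, ← Multiset.map_coe, Multiset.coe_toList]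
  rw [← MonoidHom.mem_ker, Abelianization.ker_of, d.comm_eq] at h3
  obtain ⟨x, hx⟩ := h3
  have h4 := d.real T hT p hp hpp (hfull (-x))
  have h5 : R.toList.prod ∈ prodSet R := ⟨_, by simp, rfl⟩
  have h6 := prodSet_mul h4 h5
  have h7 : d.a ((T.map d.val).sum + d.del (-x)) * R.toList.prod = 1 := by
    rw [add_comm, d.a_add, mul_assoc, ← hl2, ← hx, ← d.a_add, map_neg, neg_add_cancel, d.a_zero]
  rw [h7] at h6
  exact h6

theorem atom_absorb {S : Multiset G} (hS : IsMinimalProductOne S)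
    {T : Multiset (List G)} (hT : ∀ u ∈ T, d.IsUnit' u) {p : List G} (hp : p ∈ T)
    (hpp : d.IsPair p) (hfull : ∀ x, d.del x ∈ subs d.dv T) {R U : Multiset G}
    (hR : S = flat T + R) (hUR : U ≤ R) (hU0 : U ≠ 0) (hU : IsProductOne U) : False := by
  obtain ⟨R', rfl⟩ := Multiset.le_iff_exists_add.1 hUR
  have e : S = (flat T + R') + U := by rw [hR]; abel
  refine hS.2.2 ⟨flat T + R', U, e, ?_, hU0, d.absorb hT hp hpp hfull (e ▸ hS.2.1) hU, hU⟩
  have : flat T ≠ 0 := flat_ne (fun u hu => d.unit_ne (hT u hu)) (by rintro rfl; simp at hp)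
  intro h
  simp at h
  exact this h.1

theorem split_units (B : Multiset (List G)) (hB : ∀ u ∈ B, d.IsUnit' u) :
    ∃ I P, B = I + P ∧ (∀ u ∈ I, d.IsSingle u) ∧ ∀ u ∈ P, d.IsPair u := by
  classical
  refine ⟨B.filter d.IsSingle, B.filter (fun u => ¬ d.IsSingle u),
    (Multiset.filter_add_not _ _).symm, ?_, ?_⟩
  · intro g hg; exact (Multiset.mem_filter.1 hg).2
  · intro g hg
    have := Multiset.mem_filter.1 hg
    exact (hB g this.1).resolve_left this.2

theorem card_single (I : Multiset (List G)) (hI : ∀ u ∈ I, d.IsSingle u) :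
    (flat I).card = I.card := by
  induction I using Multiset.induction_on with
  | empty => simp [flat]
  | cons u I ih =>
    obtain ⟨y, hy, rfl⟩ := hI u (by simp)
    rw [flat_cons, Multiset.card_add, ih (fun v hv => hI v (by simp [hv]))]
    simp [add_comm]

theorem card_pair (I : Multiset (List G)) (hI : ∀ u ∈ I, d.IsPair u) :
    (flat I).card = 2 * I.card := by
  induction I using Multiset.induction_on with
  | empty => simp [flat]
  | cons u I ih =>
    obtain ⟨y, z, hy, hz, rfl⟩ := hI u (by simp)
    rw [flat_cons, Multiset.card_add, ih (fun v hv => hI v (by simp [hv]))]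
    simp
    ring

theorem dv_range (u : List G) : d.dv u ∈ d.del.range := ⟨_, rfl⟩

theorem subs_range (B : Multiset (List G)) : subs d.dv B ⊆ d.del.range := by
  rintro _ ⟨T, hT, rfl⟩
  apply AddSubgroup.multiset_sum_mem
  intro x hx
  obtain ⟨u, _, rfl⟩ := Multiset.mem_map.1 hx
  exact d.dv_range u

theorem stab_le {B : Multiset (List G)} : stab (subs d.dv B) ≤ d.del.range := by
  intro x hx
  have := (hx 0).2 (zero_mem_subs _ _)
  rw [add_zero] at this
  exact d.subs_range B this

/-- if all inner, split -/
theorem all_inner [NeZero n] {S : Multiset G} (hS : IsMinimalProductOne S)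
    (hI : ∀ g ∈ S, d.inn g) : S.card ≤ n := by
  by_contra hc
  push Not at hc
  obtain ⟨S', hS', hc'⟩ := exists_le_card S hc.le
  obtain ⟨U, hU, hU0, hU1⟩ := zeroSum (⊤ : AddSubgroup (ZMod n)) d.lam S' (by simp)
    (by rw [AddSubgroup.card_top, Nat.card_zmod]; omega)
  have key : ∀ V : Multiset G, (∀ g ∈ V, d.inn g) → ∀ {g}, g ∈ prodSet V → g = d.a (V.map d.lam).sum := by
    rintro V hV g ⟨l, rfl, rfl⟩
    have := d.lam_list l (by simpa using hV)
    rw [← d.a_lam this.1, this.2]; rfl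
  have key2 : ∀ V : Multiset G, (∀ g ∈ V, d.inn g) → (V.map d.lam).sum = 0 → IsProductOne V := by
    intro V hV h0
    have : V.toList.prod ∈ prodSet V := ⟨_, by simp, rfl⟩
    have h2 := key V hV this
    rw [h0, d.a_zero] at h2
    rwa [h2] at this
  obtain ⟨V, rfl⟩ := Multiset.le_iff_exists_add.1 (hU.trans hS')
  have h1 := key _ hI hS.2.1
  rw [Multiset.map_add, Multiset.sum_add, hU1, zero_add] at h1
  refine hS.2.2 ⟨U, V, rfl, hU0, ?_, key2 U (fun g hg => hI g (by simp [hg])) hU1,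
    key2 V (fun g hg => hI g (by simp [hg])) (d.a_eq_one.1 h1.symm)⟩
  rintro rfl
  have := Multiset.card_le_card hU
  simp at hc
  omega

end Dat
end DavAux

namespace DavAux

theorem arith1 {q k g m n t b : ℕ} (h1 : q * k = m) (h2 : g * m = n) (hq : 2 ≤ q) (hg : 0 < g)
    (h3 : t + k ≤ m) (h4 : n + m + 1 ≤ 2 * b) : g * k + t ≤ b := by
  obtain ⟨q', rfl⟩ := Nat.exists_eq_add_of_le hq
  obtain ⟨g', rfl⟩ := Nat.exists_eq_add_of_lt hg
  subst h1
  subst h2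
  have : 0 ≤ k * g' * q' := Nat.zero_le _
  nlinarith

namespace Dat
variable {G : Type*} [Group G] {n : ℕ} (d : Dat G n)

theorem range_stab [NeZero n] {K : AddSubgroup (ZMod n)} (h : K ≤ d.del.range) :
    K ≤ stab (d.del.range : Set (ZMod n)) := by
  intro x hx
  apply mem_stab_of
  intro y hy
  exact add_mem (h hx) hy

theorem subs_zero_ncard {ι A : Type*} [AddCommGroup A] [Finite A] (f : ι → A) (B : Multiset ι) :
    1 ≤ (subs f B).ncard := by
  rw [Nat.succ_le_iff, Set.ncard_pos]
  exact ⟨0, zero_mem_subs _ _⟩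

theorem add_one {ι : Type*} {W B : Multiset ι} (h : W ≤ B) {p : ι} (hp : p ∈ B) :
    ∃ T, W ≤ T ∧ T ≤ B ∧ p ∈ T ∧ T.card ≤ W.card + 1 := by
  by_cases hpW : p ∈ W
  · exact ⟨W, le_rfl, h, hpW, by omega⟩
  · exact ⟨p ::ₘ W, Multiset.le_cons_self _ _, (Multiset.cons_le_of_notMem hpW).2 ⟨hp, h⟩,
      by simp, by simp⟩

theorem card_range_set : (d.del.range : Set (ZMod n)).ncard = Nat.card d.del.range := rfl

theorem nonfull [NeZero n] {S : Multiset G} (hS : IsMinimalProductOne S)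
    {B : Multiset (List G)} (hB : ∀ u ∈ B, d.IsUnit' u) (hBS : flat B = S)
    {p : List G} (hp : p ∈ B) (hpp : d.IsPair p) {x : ZMod n} (hx : x ∈ subs d.dv B)
    (hx0 : (B.map d.val).sum + x = 0) (hX : subs d.dv B ≠ d.del.range) :
    S.card ≤ n + Nat.card d.del.range := by
  classical
  by_contra hc
  push Not at hc
  have hgm := d.card_ker_range
  set K := stab (subs d.dv B) with hK
  have hKr : K ≤ d.del.range := d.stab_le
  have hper := periodic_card K (le_refl K) (d.range_stab hKr)
    ((d.subs_range B).lt_of_ne hX)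
  rw [card_range_set] at hper
  have hN1 : Nat.card (K.comap d.del) * K.relIndex d.del.range = n := by
    rw [← AddSubgroup.index_comap, AddSubgroup.card_mul_index, Nat.card_zmod]
  have hN2 : K.relIndex d.del.range * Nat.card K = Nat.card d.del.range := by
    have := AddSubgroup.relIndex_mul_relIndex ⊥ K d.del.range bot_le hKr
    rw [AddSubgroup.relIndex_bot_left, AddSubgroup.relIndex_bot_left] at this
    rw [mul_comm, this]
  have hn0 : 0 < n := NeZero.pos n
  have hg0 : 0 < Nat.card d.del.ker := Nat.card_pos
  have hκ0 : 0 < Nat.card K := Nat.card_pos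
  have hX1 := subs_zero_ncard d.dv B
  set q := K.relIndex d.del.range with hq
  set κ := Nat.card K
  set g := Nat.card d.del.ker
  set m := Nat.card d.del.range
  have hq0 : 0 < q := by
    rcases Nat.eq_zero_or_pos q with h | h
    · rw [h] at hN1; omega
    · exact h
  have hq2 : 2 ≤ q := by
    by_contra h
    have : q = 1 := by omega
    rw [this] at hN2
    omega
  have hN : Nat.card (K.comap d.del) = g * κ := by
    apply Nat.eq_of_mul_eq_mul_right hq0
    rw [hN1, ← hgm, ← hN2]; ring
  obtain ⟨W, hW, hWs, hWc⟩ := chain d.dv ⊥ 0 B bot_le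
  have h0 := subs_zero_ncard d.dv (0 : Multiset (List G))
  rw [zero_add, zero_add] at hWs
  rw [zero_add, AddSubgroup.card_bot, mul_one] at hWc
  obtain ⟨T, hWT, hTB, hpT, hTc⟩ := add_one hW hp
  have hcardB : S.card ≤ 2 * B.card := by
    obtain ⟨I, P, rfl, hI, hP⟩ := d.split_units B hB
    rw [← hBS, flat_add, Multiset.card_add, d.card_single I hI, d.card_pair P hP,
      Multiset.card_add]
    omega
  have hRc : (B - T).card = B.card - T.card := Multiset.card_sub hTB
  obtain ⟨U, hU, hU0, hU1⟩ := zeroSum (K.comap d.del) d.val (B - T) (by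
      intro u hu
      exact mem_stab_of_mem_sub d.dv hW hWs (Multiset.mem_of_le (tsub_le_tsub_left hWT B) hu)) (by
      rw [hN, hRc]
      have := arith1 hN2 hgm hq2 hg0 (show T.card + κ ≤ m by omega) (show n + m + 1 ≤ 2 * B.card by omega)
      omega)
  have hUB : U ≤ B := hU.trans tsub_le_self
  obtain ⟨V, hV⟩ := Multiset.le_iff_exists_add.1 hUB
  have hTV : T ≤ V := by
    have h1 : T + U ≤ B := by
      rw [add_comm]; exact (le_tsub_iff_right hTB).1 hU
    rw [hV, add_comm] at h1
    exact Multiset.le_of_add_le_add_left h1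
  have hVB : V ≤ B := by rw [hV]; exact Multiset.le_add_left _ _
  have hxV : x ∈ subs d.dv V := subs_mono _ (hWT.trans hTV) (hWs ▸ hx)
  have hVu : ∀ u ∈ V, d.IsUnit' u := fun u hu => hB u (Multiset.mem_of_le hVB hu)
  have hUu : ∀ u ∈ U, d.IsUnit' u := fun u hu => hB u (Multiset.mem_of_le hUB hu)
  have hpV : p ∈ V := Multiset.mem_of_le hTV hpT
  have hVone := d.real V hVu p hpV hpp hxV
  have hs : (V.map d.val).sum + x = 0 := by
    rw [hV, Multiset.map_add, Multiset.sum_add, hU1, zero_add] at hx0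
    exact hx0
  rw [hs, d.a_zero] at hVone
  refine hS.2.2 ⟨flat U, flat V, by rw [← hBS, hV, flat_add], 
    flat_ne (fun u hu => d.unit_ne (hUu u hu)) hU0,
    flat_ne (fun u hu => d.unit_ne (hVu u hu)) (by rintro rfl; simp at hpV),
    d.flat_one U (fun u hu => d.unit_inn (hUu u hu)) hU1, hVone⟩

end Dat
end DavAux

namespace DavAux

theorem arith2 {g m n i o F : ℕ} (h : g * m = n) (hm : 2 ≤ m) (h1 : n ≤ i + 2 * o)
    (hF : i < m * (F + 1)) : g ≤ F + o := by
  by_contra hc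
  have h2 : F + o + 1 ≤ g := by omega
  have h3 : (F + o + 1) * m ≤ g * m := Nat.mul_le_mul_right _ h2
  have h4 : o * 2 ≤ o * m := Nat.mul_le_mul_left _ hm
  nlinarith

theorem arith3 {g m n : ℕ} (h : g * m = n) (hm : 2 ≤ m) (hg : 2 ≤ g) :
    2 * (g - 1) + (m + 1) + m ≤ n + 3 := by
  obtain ⟨m', rfl⟩ := Nat.exists_eq_add_of_le hm
  obtain ⟨g', rfl⟩ := Nat.exists_eq_add_of_le hg
  subst h
  have : 0 ≤ g' * m' := Nat.zero_le _
  have e : 2 + g' - 1 = g' + 1 := by omega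
  rw [e]
  nlinarith

namespace Dat
variable {G : Type*} [Group G] {n : ℕ} (d : Dat G n)

omit [Group G] in
theorem mem_flat {h : G} {C : Multiset (List G)} : h ∈ flat C ↔ ∃ u ∈ C, h ∈ u := by
  induction C using Multiset.induction_on with
  | empty => simp [flat]
  | cons u C ih => rw [flat_cons, Multiset.mem_add, ih]; simp

theorem del_hom (f : G → ZMod n) (T : Multiset G) :
    d.del (T.map f).sum = (T.map (fun g => d.del (f g))).sum := by
  rw [map_multiset_sum, Multiset.map_map]; rfl

theorem fin_small {G : Type*} [Group G] {n : ℕ} (d : Dat G n) [NeZero n] (hG : ¬ IsCyclic G)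
    {S : Multiset G} (hS : IsMinimalProductOne S)
    {B : Multiset (List G)} (hB : ∀ u ∈ B, d.IsUnit' u) (hBS : flat B = S)
    (hc : n + Nat.card d.del.range < S.card) {T : Multiset (List G)} (hT : T ≤ B)
    {p : List G} (hp : p ∈ T) (hpp : d.IsPair p) (hfull : ∀ x, d.del x ∈ subs d.dv T)
    (hTc : (flat T).card ≤ Nat.card d.del.range) : False := by
  obtain ⟨C, rfl⟩ := Multiset.le_iff_exists_add.1 hT
  rw [flat_add] at hBS
  obtain ⟨U, h1, h2, h3⟩ := d.d_le hG (flat C) (by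
    rw [← hBS, Multiset.card_add] at hc; omega)
  exact d.atom_absorb hS (fun u hu => hB u (Multiset.mem_add.2 (Or.inl hu))) hp hpp hfull hBS.symm h1 h2 h3

theorem full [NeZero n] (hG : ¬ IsCyclic G) {S : Multiset G} (hS : IsMinimalProductOne S)
    {I P : Multiset (List G)} (hI : ∀ u ∈ I, d.IsSingle u) (hP : ∀ u ∈ P, d.IsPair u)
    (hBS : flat (I + P) = S) (hP0 : P ≠ 0) (hm : 2 ≤ Nat.card d.del.range)
    (hg : 2 ≤ Nat.card d.del.ker) (hX : subs d.dv (I + P) = d.del.range) :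
    S.card ≤ n + Nat.card d.del.range := by
  classical
  by_contra hc
  push Not at hc
  have hB : ∀ u ∈ I + P, d.IsUnit' u := by
    intro u hu
    rcases Multiset.mem_add.1 hu with h | h
    · exact Or.inl (hI u h)
    · exact Or.inr (hP u h)
  have hgm := d.card_ker_range
  have hScard : S.card = I.card + 2 * P.card := by
    rw [← hBS, flat_add, Multiset.card_add, d.card_single I hI, d.card_pair P hP]
  obtain ⟨W, hW, hWs, hWc⟩ := chain d.dv ⊥ 0 I bot_le
  have h0 := subs_zero_ncard d.dv (0 : Multiset (List G))
  rw [zero_add, zero_add] at hWs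
  rw [zero_add, AddSubgroup.card_bot, mul_one] at hWc
  have hsr : ∀ B, (subs d.dv B).ncard ≤ Nat.card d.del.range := fun B => by
    rw [← card_range_set]
    exact Set.ncard_le_ncard (d.subs_range B) (Set.toFinite _)
  have hWI : ∀ u ∈ W, d.IsSingle u := fun u hu => hI u (Multiset.mem_of_le hW hu)
  by_cases hY : subs d.dv I = d.del.range
  · by_cases hpz : ∃ p ∈ P, d.dv p ≠ 0
    · obtain ⟨p, hp, hpz⟩ := hpz
      obtain ⟨V, hV, hVs, hVc⟩ := chain d.dv ⊥ {p} I bot_le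
      rw [AddSubgroup.card_bot, mul_one] at hVc
      have h2 : 2 ≤ (subs d.dv {p}).ncard := by
        rw [← Set.ncard_pair hpz.symm]
        refine Set.ncard_le_ncard ?_ (Set.toFinite _)
        rintro x (rfl | rfl)
        · exact zero_mem_subs _ _
        · exact (mem_subs_singleton _ _).2 (Or.inr rfl)
      have h3 := hsr ({p} + I)
      refine d.fin_small hG hS hB hBS hc (T := {p} + V) (p := p) ?_ (by simp) (hP p hp) ?_ ?_
      · rw [add_comm]
        exact add_le_add hV (Multiset.singleton_le.2 hp)
      · intro x
        rw [hVs]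
        apply subs_mono d.dv (Multiset.le_add_left I {p})
        rw [hY]
        exact ⟨x, rfl⟩
      · rw [flat_add, Multiset.card_add, d.card_single V (fun u hu => hI u (Multiset.mem_of_le hV hu)),
          d.card_pair {p} (by simpa using hP p hp), Multiset.card_singleton]
        omega
    · push Not at hpz
      obtain ⟨p, hp⟩ := Multiset.exists_mem_of_ne_zero hP0
      obtain ⟨P', rfl⟩ := Multiset.exists_cons_of_mem hp
      obtain ⟨I', rfl⟩ := Multiset.le_iff_exists_add.1 hW
      have hI' : ∀ u ∈ I', d.IsSingle u := fun u hu => hI u (Multiset.mem_add.2 (Or.inr hu))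
      have e : flat (W + I' + p ::ₘ P') = flat (W + {p}) + (flat I' + flat P') := by
        rw [← flat_add, ← flat_add, ← Multiset.singleton_add]
        congr 1
        abel
      have hsI := hsr (W + I')
      rw [Multiset.card_add, Multiset.card_cons] at hScard
      -- inner blocks
      have hinn : ∀ h ∈ flat I', d.inn h := by
        intro h hh
        obtain ⟨u, hu, hhu⟩ := mem_flat.1 hh
        obtain ⟨y, hy, rfl⟩ := hI' u hu
        rw [List.mem_singleton] at hhu
        rw [hhu]; exact hy
      set m := Nat.card d.del.range with hmdef
      have key : ∀ R' ≤ flat I', m ≤ R'.card → ∃ u : List G, u ≠ [] ∧ (u : Multiset G) ≤ R' ∧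
          u.length ≤ m ∧ d.inn u.prod ∧ d.val u ∈ d.del.ker := by
        intro R' hR' hcard
        obtain ⟨R2, hR2, hR2c⟩ := exists_le_card R' hcard
        obtain ⟨T, hT, hT0, hT1⟩ := zeroSum d.del.range (fun g => d.del (d.lam g)) R2
          (fun g _ => ⟨_, rfl⟩) (by omega)
        obtain ⟨e1, e2, e3, e4, e5⟩ := d.blkI (O := 0) (I := R')
          (fun g hg => hinn g (Multiset.mem_of_le hR' hg)) (hT.trans hR2) hT0
        refine ⟨_, e1, by simpa using e2, ?_, e4, ?_⟩
        · rw [e3, ← hR2c]; exact Multiset.card_le_card hT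
        · rw [AddMonoidHom.mem_ker, e5, d.del_hom, hT1]
      have hex : ∃ C : Multiset (List G), C.card = I'.card / m ∧ flat C ≤ flat I' ∧
          ∀ u ∈ C, u ≠ [] ∧ d.inn u.prod ∧ d.val u ∈ d.del.ker := by
        rcases Nat.eq_zero_or_pos (I'.card / m) with h | h
        · exact ⟨0, by simp [h], by rw [flat_zero]; exact Multiset.zero_le _, by simp⟩
        · obtain ⟨C, h1, h2, h3⟩ := d.extract d.del.ker m m (I'.card / m - 1) (flat I')
            (fun R' hR' hcc => key R' hR' (by omega))
            (fun R' hR' hcc => by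
              obtain ⟨u, h1, h2, h3, h4⟩ := key R' hR' hcc; exact ⟨u, h1, h2, h4⟩)
            (by
              rw [d.card_single I' hI']
              have h1 := Nat.mul_div_le I'.card m
              obtain ⟨F, hF⟩ := Nat.exists_eq_add_of_lt h
              rw [hF] at h1 ⊢
              simp only [zero_add, Nat.add_sub_cancel]
              rw [zero_add, mul_add, mul_one] at h1
              exact h1)
          exact ⟨C, by omega, h2, h3⟩
      obtain ⟨C, hC1, hC2, hC3⟩ := hex
      obtain ⟨U, hU1, hU2, hU3⟩ := d.blocks_one d.del.ker (C + P') (by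
          intro u hu
          rcases Multiset.mem_add.1 hu with h | h
          · exact hC3 u h
          · have hu' := hP u (by simp [h])
            exact ⟨d.unit_ne (Or.inr hu'), d.unit_inn (Or.inr hu'), hpz u (by simp [h])⟩) (by
          rw [Multiset.card_add, hC1]
          refine arith2 hgm hm (i := I'.card) (by omega) ?_
          exact Nat.lt_mul_div_succ _ (by omega))
      refine d.atom_absorb hS (T := W + {p}) (p := p) ?_ (by simp) (hP p hp) ?_
        (hBS.symm.trans e) (hU1.trans ?_) hU2 hU3
      · intro u hu
        rcases Multiset.mem_add.1 hu with h | h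
        · exact Or.inl (hWI u h)
        · rw [Multiset.mem_singleton.1 h]; exact Or.inr (hP p hp)
      · intro x
        apply subs_mono d.dv (Multiset.le_add_right W {p})
        rw [hWs, hY]
        exact ⟨x, rfl⟩
      · rw [flat_add]
        exact add_le_add hC2 le_rfl
  · -- Y is not full
    set L := stab (subs d.dv I) with hL
    obtain ⟨W1, hW1, hW1s, hW1c⟩ := chain d.dv L W P (by rw [hWs])
    have hWP : subs d.dv (W + P) = subs d.dv (I + P) := by
      ext x
      rw [mem_subs_add, mem_subs_add, hWs]
    rw [hWP, hX] at hW1s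
    rw [hWP, hX, card_range_set, hWs] at hW1c
    have hW10 : W1 ≠ 0 := by
      rintro rfl
      rw [add_zero, hWs] at hW1s
      exact hY hW1s
    obtain ⟨p, hp⟩ := Multiset.exists_mem_of_ne_zero hW10
    have hW1P : ∀ u ∈ W1, d.IsPair u := fun u hu => hP u (Multiset.mem_of_le hW1 hu)
    have hfT : (flat (W + W1)).card = W.card + 2 * W1.card := by
      rw [flat_add, Multiset.card_add, d.card_single W hWI, d.card_pair W1 hW1P]
    have hfull : ∀ x, d.del x ∈ subs d.dv (W + W1) := by
      intro x; rw [hW1s]; exact ⟨x, rfl⟩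
    have hL0 : 0 < Nat.card L := Nat.card_pos
    by_cases hl : 2 ≤ Nat.card L
    · refine d.fin_small hG hS hB hBS hc (T := W + W1) (p := p) (add_le_add hW hW1)
        (by simp [hp]) (hW1P p hp) hfull ?_
      have : W1.card * 2 ≤ W1.card * Nat.card L := Nat.mul_le_mul_left _ hl
      omega
    · have hl1 : Nat.card L = 1 := by omega
      have hLbot : L = ⊥ := AddSubgroup.card_eq_one.1 hl1
      rw [hl1, mul_one] at hW1c
      have e : flat (I + P) = flat (W + W1) + (flat (I - W) + flat (P - W1)) := by
        rw [← flat_add, ← flat_add, add_add_add_comm, add_tsub_cancel_of_le hW,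
          add_tsub_cancel_of_le hW1]
      have hRc : (flat (I - W) + flat (P - W1)).card + (W.card + 2 * W1.card) = S.card := by
        rw [← hBS, e, Multiset.card_add (flat (W + W1)), hfT, add_comm]
      set R := flat (I - W) + flat (P - W1) with hR
      have hin : ∀ h ∈ R, d.inn h → d.lam h ∈ d.del.ker := by
        intro h hh hhi
        rcases Multiset.mem_add.1 hh with hh | hh
        · obtain ⟨u, hu, hhu⟩ := mem_flat.1 hh
          obtain ⟨y, hy, rfl⟩ := hI u (Multiset.mem_of_le tsub_le_self hu)
          rw [List.mem_singleton] at hhu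
          have := mem_stab_of_mem_sub d.dv hW hWs hu
          rw [← hL, hLbot, AddSubgroup.mem_bot] at this
          rw [hhu, AddMonoidHom.mem_ker, ← this]
          simp [dv, val]
        · obtain ⟨u, hu, hhu⟩ := mem_flat.1 hh
          obtain ⟨y, z, hy, hz, rfl⟩ := hP u (Multiset.mem_of_le tsub_le_self hu)
          exfalso
          simp only [List.mem_cons, List.not_mem_nil, or_false] at hhu
          rcases hhu with rfl | rfl
          · exact hy hhi
          · exact hz hhi
      set m := Nat.card d.del.range with hmdef
      have key : ∀ R' ≤ R, m + 1 ≤ R'.card → ∃ u : List G, u ≠ [] ∧ (u : Multiset G) ≤ R' ∧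
          u.length ≤ 2 ∧ d.inn u.prod ∧ d.val u ∈ d.del.ker := by
        intro R' hR' hcard
        by_cases hex : ∃ h ∈ R', d.inn h
        · obtain ⟨h, hh, hhi⟩ := hex
          refine ⟨[h], by simp, by simpa using hh, by simp, by simpa using hhi, ?_⟩
          have := hin h (Multiset.mem_of_le hR' hh) hhi
          simpa [val] using this
        · push Not at hex
          obtain ⟨y, z, O', rfl, he⟩ := dup_of_card (fun g => d.del (d.xo g)) R' d.del.range
            (Set.toFinite _) (fun g _ => ⟨_, rfl⟩) (by rw [card_range_set]; omega)
          have hy := hex y (by simp)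
          have hz := hex z (by simp)
          refine ⟨[y, z], by simp, ?_, by simp, by simpa using d.inn_out hy hz, ?_⟩
          · change y ::ₘ z ::ₘ 0 ≤ _
            simp
          · have h1 : d.val [y, z] = d.xo y + d.r * d.xo z + d.lam (d.t * d.t) := by
              rw [← d.lam_out hy hz]; simp [val]
            have h2 : d.del (d.lam (d.t * d.t)) = 0 := d.lam_sq d.t_not
            rw [AddMonoidHom.mem_ker, h1, map_add, map_add, d.del_r, h2, he]
            simp
      have hA := arith3 hgm hm hg
      have hY1 := subs_zero_ncard d.dv I
      obtain ⟨C, h1, h2, h3⟩ := d.extract d.del.ker (m + 1) 2 (Nat.card d.del.ker - 1) R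
        (fun R' hR' hcc => key R' hR' (by omega))
        (fun R' hR' hcc => by
          obtain ⟨u, h1, h2, h3, h4⟩ := key R' hR' hcc; exact ⟨u, h1, h2, h4⟩)
        (by omega)
      obtain ⟨U, hU1, hU2, hU3⟩ := d.blocks_one d.del.ker C h3 (by omega)
      exact d.atom_absorb hS (T := W + W1) (p := p)
        (fun u hu => hB u (Multiset.mem_of_le (add_le_add hW hW1) hu)) (by simp [hp]) (hW1P p hp) hfull
        (hBS.symm.trans e) (hU1.trans h2) hU2 hU3

/-- upper bound for atoms -/
theorem D_le {G : Type*} [Group G] [Finite G] {n : ℕ} (d : Dat G n) [NeZero n]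
    (hG : ¬ IsCyclic G) (hcard : Nat.card G = 2 * n) {S : Multiset G}
    (hS : IsMinimalProductOne S) : S.card ≤ n + Nat.card d.del.range := by
  have hgm := d.card_ker_range
  have hm0 : 0 < Nat.card d.del.range := Nat.card_pos
  have hg0 : 0 < Nat.card d.del.ker := Nat.card_pos
  by_cases hg1 : Nat.card d.del.ker = 1
  · rw [hg1, one_mul] at hgm
    have := splits_of_gt hS
    omega
  by_cases hm1 : Nat.card d.del.range = 1
  · by_contra hc
    have hcomm : ∀ x y : G, x * y = y * x := by
      have h1 := d.card_comm
      rw [hm1, Subgroup.card_eq_one, commutator_eq_bot_iff_center_eq_top] at h1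
      intro x y
      have : y ∈ Subgroup.center G := by rw [h1]; trivial
      exact Subgroup.mem_center_iff.1 this x
    obtain ⟨S', hS', hS'c⟩ := exists_le_card S (show n + 1 ≤ S.card by omega)
    obtain ⟨U, h1, h2, h3⟩ := d.d_le hG S' hS'c.ge
    obtain ⟨V, rfl⟩ := Multiset.le_iff_exists_add.1 (h1.trans hS')
    refine hS.2.2 ⟨U, V, rfl, h2, ?_, h3, ?_⟩
    · rintro rfl
      have := Multiset.card_le_card h1
      rw [add_zero] at hc
      omega
    · let _ : CommGroup G := { ‹Group G› with mul_comm := hcomm }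
      have h4 := prodOne_abel (MonoidHom.id G) hS.2.1
      have h5 := prodOne_abel (MonoidHom.id G) h3
      rw [Multiset.map_add, Multiset.prod_add, h5, one_mul] at h4
      refine ⟨V.toList, by simp, ?_⟩
      rw [← h4]
      conv_rhs => rw [← Multiset.coe_toList V]
      rw [Multiset.map_coe, Multiset.prod_coe]
      simp
  have hS1 := hS.2.1
  obtain ⟨l, hl, hl1⟩ := hS1
  obtain ⟨B, hB, hBS, x, hx, hx1⟩ := (d.decomp l).1 (by rw [hl1]; exact d.inn_one)
  rw [hl] at hBS
  rw [hl1] at hx1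
  have hx0 := d.a_eq_one.1 hx1.symm
  by_cases hpair : ∃ p ∈ B, d.IsPair p
  · obtain ⟨p, hp, hpp⟩ := hpair
    by_cases hX : subs d.dv B = d.del.range
    · obtain ⟨I, P, rfl, hI, hP⟩ := d.split_units B hB
      refine d.full hG hS hI hP hBS ?_ (by omega) (by omega) hX
      rintro rfl
      rw [add_zero] at hp
      obtain ⟨y, hy, rfl⟩ := hI p hp
      obtain ⟨y', z', _, _, h⟩ := hpp
      simp at h
    · exact d.nonfull hS hB hBS hp hpp hx hx0 hX
  · push Not at hpair
    refine (d.all_inner hS ?_).trans (by omega)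
    intro h hh
    rw [← hBS] at hh
    obtain ⟨u, hu, hhu⟩ := mem_flat.1 hh
    obtain ⟨y, hy, rfl⟩ := (hB u hu).resolve_right (hpair u hu)
    rw [List.mem_singleton] at hhu
    rw [hhu]; exact hy

end Dat
end DavAux

namespace DavAux
namespace Dat
variable {G : Type*} [Group G] {n : ℕ} (d : Dat G n)

theorem io_unique {I O I' O' : Multiset G} (hI : ∀ g ∈ I, d.inn g) (hI' : ∀ g ∈ I', d.inn g)
    (hO : ∀ g ∈ O, ¬ d.inn g) (hO' : ∀ g ∈ O', ¬ d.inn g) (h : I + O = I' + O') :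
    I = I' ∧ O = O' := by
  classical
  have h1 := congrArg (Multiset.filter d.inn) h
  rw [Multiset.filter_add, Multiset.filter_add, Multiset.filter_eq_self.2 hI,
    Multiset.filter_eq_self.2 hI', Multiset.filter_eq_nil.2 hO, Multiset.filter_eq_nil.2 hO',
    add_zero, add_zero] at h1
  subst h1
  exact ⟨rfl, add_left_cancel h⟩

theorem one_units {T : Multiset G} (hT : IsProductOne T) : ∃ I P : Multiset (List G),
    (∀ u ∈ I, d.IsSingle u) ∧ (∀ u ∈ P, d.IsPair u) ∧ flat I + flat P = T ∧
    ∃ x ∈ subs d.dv (I + P), ((I + P).map d.val).sum + x = 0 := by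
  obtain ⟨l, hl, hl1⟩ := hT
  obtain ⟨B, hB, hBS, x, hx, hx1⟩ := (d.decomp l).1 (by rw [hl1]; exact d.inn_one)
  rw [hl] at hBS
  rw [hl1] at hx1
  have hx0 := d.a_eq_one.1 hx1.symm
  obtain ⟨I, P, rfl, hI, hP⟩ := d.split_units B hB
  exact ⟨I, P, hI, hP, by rw [← flat_add, hBS], x, hx, hx0⟩

theorem flat_inner {I : Multiset (List G)} (hI : ∀ u ∈ I, d.IsSingle u) : ∀ g ∈ flat I, d.inn g := by
  intro h hh
  obtain ⟨u, hu, hhu⟩ := mem_flat.1 hh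
  obtain ⟨y, hy, rfl⟩ := hI u hu
  rw [List.mem_singleton] at hhu
  rw [hhu]; exact hy

theorem flat_outer {P : Multiset (List G)} (hP : ∀ u ∈ P, d.IsPair u) :
    ∀ g ∈ flat P, ¬ d.inn g := by
  intro h hh
  obtain ⟨u, hu, hhu⟩ := mem_flat.1 hh
  obtain ⟨y, z, hy, hz, rfl⟩ := hP u hu
  simp only [List.mem_cons, List.not_mem_nil, or_false] at hhu
  rcases hhu with rfl | rfl
  · exact hy
  · exact hz

theorem rep_one {j : ℕ} (h : IsProductOne (Multiset.replicate j (d.a 1))) : n ∣ j := by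
  obtain ⟨l, hl, hl1⟩ := h
  have : l = List.replicate j (d.a 1) := by
    rw [← Multiset.coe_replicate, Multiset.coe_eq_coe] at hl
    exact List.perm_replicate.1 hl
  rw [this, List.prod_replicate, ← d.a_nsmul, d.a_eq_one, nsmul_eq_mul, mul_one,
    ZMod.natCast_eq_zero_iff] at hl1
  exact hl1

theorem rep_inner {j : ℕ} : ∀ g ∈ Multiset.replicate j (d.a 1), d.inn g := by
  intro g hg
  rw [Multiset.eq_of_mem_replicate hg]
  exact d.inn_a 1

/-- lower bound for d -/
theorem free_ex {G : Type*} [Group G] {n : ℕ} (d : Dat G n) [NeZero n] : ∃ S : Multiset G, ProductOneFree S ∧ S.card = n := by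
  have hn : 0 < n := NeZero.pos n
  refine ⟨Multiset.replicate (n - 1) (d.a 1) + {d.t}, ?_, by simp; omega⟩
  intro T hT hT0 hT1
  obtain ⟨V, hV⟩ := Multiset.le_iff_exists_add.1 hT
  obtain ⟨I, P, hI, hP, hf, -⟩ := d.one_units hT1
  obtain ⟨I', O', rfl, hI', hO'⟩ := d.split_io V
  rw [← hf, add_add_add_comm] at hV
  obtain ⟨h1, h2⟩ := d.io_unique d.rep_inner (I' := flat I + I') (O' := flat P + O')
    (fun g hg => (Multiset.mem_add.1 hg).elim (d.flat_inner hI g) (hI' g))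
    (by simpa using d.t_not)
    (fun g hg => (Multiset.mem_add.1 hg).elim (d.flat_outer hP g) (hO' g)) hV
  have h3 := congrArg Multiset.card h2
  rw [Multiset.card_add, d.card_pair P hP, Multiset.card_singleton] at h3
  have hP0 : P = 0 := Multiset.card_eq_zero.1 (by omega)
  rw [hP0, flat_zero, add_zero] at hf
  have h4 : flat I ≤ Multiset.replicate (n - 1) (d.a 1) := by
    rw [h1]; exact Multiset.le_add_right _ _
  have h5 : T = Multiset.replicate T.card (d.a 1) := by
    rw [Multiset.eq_replicate]
    refine ⟨rfl, fun b hb => ?_⟩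
    rw [← hf] at hb
    exact Multiset.eq_of_mem_replicate (Multiset.mem_of_le h4 hb)
  have h6 : T.card ≤ n - 1 := by
    have := Multiset.card_le_card h4
    rwa [Multiset.card_replicate, hf] at this
  rw [h5] at hT1
  have h7 := d.rep_one hT1
  have h8 : 0 < T.card := Multiset.card_pos.2 hT0
  have := Nat.le_of_dvd h8 h7
  omega

theorem card_range_order : Nat.card d.del.range = addOrderOf (d.r - 1) := by
  rw [← Nat.card_zmultiples]
  have : d.del.range = AddSubgroup.zmultiples (d.r - 1) := by
    ext x
    constructor
    · rintro ⟨y, rfl⟩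
      rw [d.del_apply]
      obtain ⟨k, rfl⟩ := ZMod.intCast_surjective y
      exact ⟨k, by simp [mul_comm]⟩
    · rintro ⟨k, rfl⟩
      exact ⟨k, by simp [d.del_apply, mul_comm]⟩
  rw [this]

/-- the second outer element of the long atom -/
noncomputable def alp : ZMod n := d.r + 1 - (Nat.card d.del.range : ZMod n)

noncomputable def zz : G := d.t⁻¹ * d.a d.alp

theorem zz_not : ¬ d.inn d.zz := by
  intro h
  exact d.inv_not d.t_not ((d.inn_mul_iff_right (d.inn_a _)).1 h)

theorem m_r : (Nat.card d.del.range : ZMod n) * (d.r - 1) = 0 := by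
  rw [card_range_order, ← nsmul_eq_mul, addOrderOf_nsmul_eq_zero]

theorem val_tz : d.val [d.t, d.zz] = d.alp := by
  simp [val, zz, d.lam_a]

theorem val_zt : d.val [d.zz, d.t] = d.alp := by
  have h := d.lam_swap d.t_not d.zz_not
  have h1 := d.val_tz
  simp only [val, List.prod_cons, List.prod_nil, mul_one] at h1 ⊢
  rw [h, h1, alp]
  linear_combination d.r_sq - d.m_r

theorem del_alp : d.del d.alp = 0 := by
  rw [d.del_apply, alp]
  linear_combination d.r_sq - d.m_r

theorem pair_eq {α : Type*} {y w t z : α} (h : ({y, w} : Multiset α) = {t, z}) :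
    (y = t ∧ w = z) ∨ (y = z ∧ w = t) := by
  have h' : y ::ₘ {w} = t ::ₘ {z} := h
  rw [Multiset.cons_eq_cons] at h'
  rcases h' with ⟨h1, h2⟩ | ⟨_, cs, h1, h2⟩
  · exact Or.inl ⟨h1, by simpa using h2⟩
  · right
    have h3 : cs = 0 := by
      have := congrArg Multiset.card h1
      simp at this
      exact this
    subst h3
    simp at h1 h2
    exact ⟨h2.symm, h1⟩

theorem not_one {k : ℕ} (hk : k + 2 = Nat.card d.del.range) :
    ¬ IsProductOne (Multiset.replicate k (d.a 1) + {d.t, d.zz}) := by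
  intro h
  obtain ⟨I, P, hI, hP, hf, x, hx, hx0⟩ := d.one_units h
  have hout : ∀ g ∈ ({d.t, d.zz} : Multiset G), ¬ d.inn g := by
    intro g hg
    simp at hg
    rcases hg with rfl | rfl
    · exact d.t_not
    · exact d.zz_not
  obtain ⟨h1, h2⟩ := d.io_unique (d.flat_inner hI) d.rep_inner (d.flat_outer hP) hout hf
  have h3 := congrArg Multiset.card h2
  rw [d.card_pair P hP] at h3
  have hP1 : P.card = 1 := by simp at h3; omega
  obtain ⟨p, rfl⟩ := Multiset.card_eq_one.1 hP1
  obtain ⟨y, w, hy, hw, rfl⟩ := hP p (by simp)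
  have h4 : d.val [y, w] = d.alp := by
    have : ({y, w} : Multiset G) = {d.t, d.zz} := by
      rw [← h2]; simp [flat]; rfl
    rcases pair_eq this with ⟨rfl, rfl⟩ | ⟨rfl, rfl⟩
    · exact d.val_tz
    · exact d.val_zt
  have h5 : I = Multiset.replicate k [d.a 1] := by
    rw [Multiset.eq_replicate]
    refine ⟨?_, ?_⟩
    · rw [← d.card_single I hI, h1, Multiset.card_replicate]
    · intro u hu
      obtain ⟨g, hg, rfl⟩ := hI u hu
      have : g ∈ flat I := mem_flat.2 ⟨[g], hu, by simp⟩
      rw [h1] at this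
      rw [Multiset.eq_of_mem_replicate this]
  have hv1 : d.val [d.a 1] = 1 := by simp [val, d.lam_a]
  obtain ⟨x1, ⟨T, hT, rfl⟩, x2, hx2, rfl⟩ := (mem_subs_add _).1 hx
  have hx2' : x2 = 0 := by
    rcases (mem_subs_singleton _ _).1 hx2 with h | h
    · exact h
    · rw [h, dv, h4, d.del_alp]
  rw [h5] at hT hx0
  have hT2 : T = Multiset.replicate T.card [d.a 1] := by
    rw [Multiset.eq_replicate]
    exact ⟨rfl, fun b hb => Multiset.eq_of_mem_replicate (Multiset.mem_of_le hT hb)⟩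
  have hTc : T.card ≤ k := by
    have := Multiset.card_le_card hT
    rwa [Multiset.card_replicate] at this
  rw [hx2', hT2] at hx0
  simp only [Multiset.map_add, Multiset.sum_add, Multiset.map_replicate, Multiset.sum_replicate,
    Multiset.map_singleton, Multiset.sum_singleton, hv1, h4, dv, d.del_apply, mul_one, add_zero,
    nsmul_eq_mul] at hx0
  have h6 : (T.card + 1) • (d.r - 1) = 0 := by
    rw [← hx0, alp, ← hk]
    push_cast
    rw [nsmul_eq_mul]
    push_cast
    ring
  have h7 := addOrderOf_dvd_of_nsmul_eq_zero h6
  rw [← card_range_order] at h7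
  have := Nat.le_of_dvd (by omega) h7
  omega

theorem atom_aux [NeZero n] {T T' : Multiset G}
    (h : Multiset.replicate (n + Nat.card d.del.range - 2) (d.a 1) + {d.t, d.zz} = T + T')
    (hT : ∀ g ∈ T, d.inn g) (h0 : T ≠ 0) (h1 : IsProductOne T) (h2 : IsProductOne T') : False := by
  have hout : ∀ g ∈ ({d.t, d.zz} : Multiset G), ¬ d.inn g := by
    intro g hg
    simp at hg
    rcases hg with rfl | rfl
    · exact d.t_not
    · exact d.zz_not
  obtain ⟨I', O', rfl, hI', hO'⟩ := d.split_io T'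
  rw [← add_assoc] at h
  obtain ⟨h3, h4⟩ := d.io_unique d.rep_inner (I' := T + I')
    (fun g hg => (Multiset.mem_add.1 hg).elim (hT g) (hI' g)) hout hO' h
  have h5 : ∀ V ≤ T + I', V = Multiset.replicate V.card (d.a 1) := by
    intro V hV
    rw [← h3] at hV
    rw [Multiset.eq_replicate]
    exact ⟨rfl, fun b hb => Multiset.eq_of_mem_replicate (Multiset.mem_of_le hV hb)⟩
  have hTr := h5 T (Multiset.le_add_right _ _)
  have hIr := h5 I' (Multiset.le_add_left _ _)
  have hc := congrArg Multiset.card h3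
  rw [Multiset.card_replicate, Multiset.card_add] at hc
  rw [hTr] at h1
  have hd := d.rep_one h1
  have hpos : 0 < T.card := Multiset.card_pos.2 h0
  have hn : 0 < n := NeZero.pos n
  have hgm := d.card_ker_range
  have hg0 : 0 < Nat.card d.del.ker := Nat.card_pos
  have hm0 : 0 < Nat.card d.del.range := Nat.card_pos
  have hmn : Nat.card d.del.range ≤ n := by
    calc Nat.card d.del.range = 1 * Nat.card d.del.range := (one_mul _).symm
      _ ≤ Nat.card d.del.ker * Nat.card d.del.range := Nat.mul_le_mul_right _ hg0
      _ = n := hgm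
  obtain ⟨c, hcc⟩ := hd
  have hc1 : c = 1 := by
    rcases Nat.lt_or_ge c 2 with h | h
    · interval_cases c
      · omega
      · rfl
    · have : n * 2 ≤ n * c := Nat.mul_le_mul_left _ h
      omega
  rw [hc1, mul_one] at hcc
  rw [hIr, ← h4] at h2
  exact d.not_one (k := I'.card) (by omega) h2

theorem atom_ex [NeZero n] : ∃ S : Multiset G, IsMinimalProductOne S ∧
    S.card = n + Nat.card d.del.range := by
  have hn : 0 < n := NeZero.pos n
  have hm0 : 0 < Nat.card d.del.range := Nat.card_pos
  refine ⟨Multiset.replicate (n + Nat.card d.del.range - 2) (d.a 1) + {d.t, d.zz}, ⟨?_, ?_, ?_⟩, ?_⟩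
  · intro h
    have := congrArg Multiset.card h
    simp at this
  · have hpp : d.IsPair [d.t, d.zz] := ⟨_, _, d.t_not, d.zz_not, rfl⟩
    have hv1 : d.val [d.a 1] = 1 := by simp [val, d.lam_a]
    have h1 := d.real (Multiset.replicate (n + Nat.card d.del.range - 2) [d.a 1] + {[d.t, d.zz]})
      (by
        intro u hu
        rcases Multiset.mem_add.1 hu with h | h
        · rw [Multiset.eq_of_mem_replicate h]; exact Or.inl ⟨_, d.inn_a 1, rfl⟩
        · rw [Multiset.mem_singleton.1 h]; exact Or.inr hpp) [d.t, d.zz] (by simp) hpp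
      (x := ((Nat.card d.del.range - 1 : ℕ) : ZMod n) * (d.r - 1))
      ⟨Multiset.replicate (Nat.card d.del.range - 1) [d.a 1],
        (Multiset.replicate_mono _ (by omega)).trans (Multiset.le_add_right _ _), by
          simp [dv, hv1, d.del_apply]⟩
    have h2 : flat (Multiset.replicate (n + Nat.card d.del.range - 2) [d.a 1] + {[d.t, d.zz]}) =
        Multiset.replicate (n + Nat.card d.del.range - 2) (d.a 1) + {d.t, d.zz} := by
      rw [flat_add]
      congr 1
      · simp [flat, Multiset.nsmul_singleton]
    rw [h2] at h1
    unfold IsProductOne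
    convert h1 using 1
    symm
    rw [d.a_eq_one]
    simp only [Multiset.map_add, Multiset.sum_add, Multiset.map_replicate, Multiset.sum_replicate,
      Multiset.map_singleton, Multiset.sum_singleton, hv1, d.val_tz, nsmul_eq_mul, mul_one]
    have e1 : ((n + Nat.card d.del.range - 2 : ℕ) : ZMod n) = Nat.card d.del.range - 2 := by
      rw [Nat.cast_sub (by omega)]; simp
    rw [e1, Nat.cast_sub (by omega), alp]
    push_cast
    linear_combination d.m_r
  · rintro ⟨T, T', h, hT0, hT0', hT, hT'⟩
    obtain ⟨I, P, hI, hP, hf, -⟩ := d.one_units hT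
    obtain ⟨I', P', hI', hP', hf', -⟩ := d.one_units hT'
    have hout : ∀ g ∈ ({d.t, d.zz} : Multiset G), ¬ d.inn g := by
      intro g hg
      simp at hg
      rcases hg with rfl | rfl
      · exact d.t_not
      · exact d.zz_not
    have h' := h
    rw [← hf, ← hf', add_add_add_comm] at h'
    have h2 := (d.io_unique d.rep_inner (I' := flat I + flat I') (O' := flat P + flat P')
      (fun g hg => (Multiset.mem_add.1 hg).elim (d.flat_inner hI g) (d.flat_inner hI' g)) hout
      (fun g hg => (Multiset.mem_add.1 hg).elim (d.flat_outer hP g) (d.flat_outer hP' g)) h').2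
    have h3 := congrArg Multiset.card h2
    rw [Multiset.card_add, d.card_pair P hP, d.card_pair P' hP'] at h3
    simp at h3
    have h4 : P.card = 0 ∨ P'.card = 0 := by omega
    rcases h4 with h4 | h4
    · rw [Multiset.card_eq_zero.1 h4, flat_zero, add_zero] at hf
      exact d.atom_aux h (by rw [← hf]; exact d.flat_inner hI) hT0 hT hT'
    · rw [Multiset.card_eq_zero.1 h4, flat_zero, add_zero] at hf'
      exact d.atom_aux (h.trans (add_comm _ _)) (by rw [← hf']; exact d.flat_inner hI') hT0' hT' hT
  · rw [Multiset.card_add, Multiset.card_replicate, Multiset.card_pair]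
    omega

end Dat
end DavAux

namespace DavAux

theorem exists_dat {G : Type*} [Group G] [Finite G] (H : Subgroup G) (hc : IsCyclic H)
    (hi : H.index = 2) : ∃ n, NeZero n ∧ Nat.card G = 2 * n ∧ Nonempty (Dat G n) := by
  have hN : H.Normal := Subgroup.normal_of_index_eq_two hi
  have hn0 : NeZero (Nat.card H) := ⟨Nat.card_pos.ne'⟩
  refine ⟨Nat.card H, hn0, ?_, ?_⟩
  · rw [← H.card_mul_index, hi, mul_comm]
  let e : Multiplicative (ZMod (Nat.card H)) ≃* H := zmodCyclicMulEquiv hc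
  let a : ZMod (Nat.card H) → G := fun x => (e (Multiplicative.ofAdd x) : G)
  have a_add : ∀ x y, a (x + y) = a x * a y := by
    intro x y
    simp [a, ofAdd_add]
  have a_inj : Function.Injective a := by
    intro x y h
    have := e.injective (Subtype.ext h)
    exact Multiplicative.ofAdd.injective this
  have a_mem : ∀ g, (∃ x, a x = g) ↔ g ∈ H := by
    intro g
    constructor
    · rintro ⟨x, rfl⟩
      exact (e (Multiplicative.ofAdd x)).2
    · intro hg
      refine ⟨Multiplicative.toAdd (e.symm ⟨g, hg⟩), ?_⟩
      simp [a]
  have a_not : ∀ g, (∀ x, a x ≠ g) ↔ g ∉ H := by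
    intro g
    rw [← a_mem]; simp
  have hex : ∃ t, t ∉ H := by
    by_contra h
    push Not at h
    rw [(Subgroup.eq_top_iff' H).2 h, Subgroup.index_top] at hi
    omega
  obtain ⟨t, ht⟩ := hex
  obtain ⟨r, hr⟩ := (a_mem _).2 (hN.conj_mem (a 1) ((a_mem _).1 ⟨1, rfl⟩) t)
  have a_zero : a 0 = 1 := by simp [a]
  have a_nsmul : ∀ (k : ℕ) x, a (k • x) = a x ^ k := by
    intro k x
    induction k with
    | zero => simp [a_zero]
    | succ k ih => rw [succ_nsmul, a_add, ih, pow_succ]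
  have ht2 : ∀ x, t * a x * t⁻¹ = a (r * x) := by
    intro x
    have h1 : x = x.val • (1 : ZMod (Nat.card H)) := by simp
    have h2 : r * x = x.val • r := by simp [mul_comm]
    rw [h2, a_nsmul, hr, conj_pow]
    conv_lhs => rw [h1, a_nsmul]
  refine ⟨⟨a, a_add, a_inj, t, r, (a_not t).2 ht, ?_, ?_⟩⟩
  · intro y z hy hz
    rw [a_mem, Subgroup.mul_mem_iff_of_index_two hi]
    exact iff_of_false ((a_not y).1 hy) ((a_not z).1 hz)
  · intro y hy x
    have h1 : y * t⁻¹ ∈ H := by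
      rw [Subgroup.mul_mem_iff_of_index_two hi]
      exact iff_of_false ((a_not y).1 hy) (by simpa using ht)
    obtain ⟨x0, hx0⟩ := (a_mem _).2 h1
    have h2 : y = a x0 * t := by rw [hx0]; simp
    have h3 : t * a x = a (r * x) * t := by rw [← ht2]; simp
    rw [h2, mul_assoc, h3, ← mul_assoc, ← mul_assoc, ← a_add, ← a_add, add_comm]

theorem small_eq {G : Type*} [Group G] (k : ℕ)
    (h1 : ∀ S : Multiset G, k + 1 ≤ S.card → ∃ U ≤ S, U ≠ 0 ∧ IsProductOne U)
    (h2 : ∃ S : Multiset G, ProductOneFree S ∧ S.card = k) : smallDavenport G = (k : ℕ∞) := by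
  apply le_antisymm
  · apply sSup_le
    rintro _ ⟨S, hS, rfl⟩
    rw [Nat.cast_le]
    by_contra hc
    obtain ⟨U, hU, hU0, hU1⟩ := h1 S (by omega)
    exact hS U hU hU0 hU1
  · obtain ⟨S, hS, hc⟩ := h2
    exact le_sSup ⟨S, hS, by rw [hc]⟩

theorem large_eq {G : Type*} [Group G] (k : ℕ)
    (h1 : ∀ S : Multiset G, IsMinimalProductOne S → S.card ≤ k)
    (h2 : ∃ S : Multiset G, IsMinimalProductOne S ∧ S.card = k) : largeDavenport G = (k : ℕ∞) := by
  apply le_antisymm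
  · apply sSup_le
    rintro _ ⟨S, hS, rfl⟩
    rw [Nat.cast_le]
    exact h1 S hS
  · obtain ⟨S, hS, hc⟩ := h2
    exact le_sSup ⟨S, hS, by rw [hc]⟩

theorem rep_cyc {G : Type*} [Group G] {g : G} {j : ℕ} :
    IsProductOne (Multiset.replicate j g) ↔ orderOf g ∣ j := by
  rw [orderOf_dvd_iff_pow_eq_one]
  constructor
  · rintro ⟨l, hl, hl1⟩
    rw [← Multiset.coe_replicate, Multiset.coe_eq_coe] at hl
    rw [List.perm_replicate.1 hl, List.prod_replicate] at hl1
    exact hl1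
  · intro h
    exact ⟨List.replicate j g, Multiset.coe_replicate _ _, by simpa using h⟩

theorem le_rep {G : Type*} {g : G} {j : ℕ} {T : Multiset G} (h : T ≤ Multiset.replicate j g) :
    T = Multiset.replicate T.card g ∧ T.card ≤ j := by
  constructor
  · rw [Multiset.eq_replicate]
    exact ⟨rfl, fun b hb => Multiset.eq_of_mem_replicate (Multiset.mem_of_le h hb)⟩
  · have := Multiset.card_le_card h
    rwa [Multiset.card_replicate] at this

theorem cyc {G : Type*} [Group G] [Finite G] (hG : IsCyclic G) :
    smallDavenport G = ((Nat.card G - 1 : ℕ) : ℕ∞) ∧ largeDavenport G = (Nat.card G : ℕ∞) ∧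
      Nat.card (commutator G) = 1 := by
  have hpos : 0 < Nat.card G := Nat.card_pos
  obtain ⟨g, hg⟩ := hG.exists_generator
  have ho : orderOf g = Nat.card G := orderOf_eq_card_of_forall_mem_zpowers hg
  refine ⟨small_eq _ (fun S hS => free_lt (by omega)) ?_, large_eq _ (fun S hS => splits_of_gt hS) ?_, ?_⟩
  · refine ⟨Multiset.replicate (Nat.card G - 1) g, ?_, by simp⟩
    intro T hT h0 h1
    obtain ⟨h2, h3⟩ := le_rep hT
    rw [h2, rep_cyc, ho] at h1
    have := Nat.le_of_dvd (Multiset.card_pos.2 h0) h1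
    omega
  · refine ⟨Multiset.replicate (Nat.card G) g, ⟨?_, ?_, ?_⟩, by simp⟩
    · intro h
      have := congrArg Multiset.card h
      rw [Multiset.card_replicate, Multiset.card_zero] at this
      omega
    · rw [rep_cyc, ho]
    · rintro ⟨T, T', h, h0, h0', h1, h1'⟩
      have hT := le_rep (show T ≤ Multiset.replicate (Nat.card G) g by
        rw [h]; exact Multiset.le_add_right _ _)
      have hc := congrArg Multiset.card h
      rw [Multiset.card_replicate, Multiset.card_add] at hc
      rw [hT.1, rep_cyc, ho] at h1
      have := Nat.le_of_dvd (Multiset.card_pos.2 h0) h1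
      have := Multiset.card_pos.2 h0'
      omega
  · rw [Subgroup.card_eq_one, commutator_eq_bot_iff_center_eq_top, Subgroup.eq_top_iff']
    intro x
    rw [Subgroup.mem_center_iff]
    intro y
    obtain ⟨i, rfl⟩ := hg x
    obtain ⟨j, rfl⟩ := hg y
    simp only [← zpow_add, add_comm]

end DavAux

theorem largeDavenport_of_cyclic_index_two (G : Type*) [Group G] [Finite G]
    (h : ∃ H : Subgroup G, IsCyclic H ∧ H.index = 2) :
    largeDavenport G = smallDavenport G + (Nat.card (commutator G) : ℕ∞) ∧
      (IsCyclic G → smallDavenport G = ((Nat.card G - 1 : ℕ) : ℕ∞)) ∧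
      (¬ IsCyclic G → smallDavenport G = ((Nat.card G / 2 : ℕ) : ℕ∞)) := by
  by_cases hG : IsCyclic G
  · obtain ⟨h1, h2, h3⟩ := DavAux.cyc hG
    refine ⟨?_, fun _ => h1, fun h => absurd hG h⟩
    rw [h1, h2, h3, ← Nat.cast_add]
    have : 0 < Nat.card G := Nat.card_pos
    congr 1
    omega
  · obtain ⟨H, hc, hi⟩ := h
    obtain ⟨n, hn, hcard, ⟨d⟩⟩ := DavAux.exists_dat H hc hi
    have h1 := DavAux.small_eq n (d.d_le hG) d.free_ex
    have h2 := DavAux.large_eq (n + Nat.card d.del.range) (fun S hS => d.D_le hG hcard hS) d.atom_ex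
    refine ⟨?_, fun h => absurd h hG, fun _ => ?_⟩
    · rw [h1, h2, d.card_comm, Nat.cast_add]
    · rw [h1, hcard]
      congr 1
      omega
end

section
/- Let G = Q_{4p} = <a, t | a^{2p} = 1, t^2 = a^p, a*t = t*a^{-1}> be the dicyclic group of order 4p with p an odd prime. Then D(G) <= 3p, where D(G) is the large Davenport constant. -/
section
namespace QD
open QuaternionGroup
variable {p : ℕ}

/-- value mod p -/
def v : QuaternionGroup p → ZMod p
  | .a i => ZMod.castHom (Dvd.intro_left 2 rfl : p ∣ 2 * p) (ZMod p) i
  | .xa i => ZMod.castHom (Dvd.intro_left 2 rfl : p ∣ 2 * p) (ZMod p) i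

/-- outside the cyclic subgroup -/
def e : QuaternionGroup p → Bool
  | .a _ => false
  | .xa _ => true

/-- doubling map -/
def d : ZMod (2 * p) →+ ZMod 4 :=
  ZMod.lift (2 * p) ⟨(AddMonoidHom.mulLeft (2 : ZMod 4)).comp (Int.castAddHom (ZMod 4)), by
    have : (2 : ZMod 4) * 2 = 0 := by decide
    simp [← mul_assoc, this]⟩

/-- type in the abelianization -/
def t : QuaternionGroup p → ZMod 4
  | .a i => d i
  | .xa i => 1 + d i

lemma d_int (k : ℤ) : d (p := p) (k : ZMod (2 * p)) = 2 * (k : ZMod 4) := by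
  simp [d]

lemma v_mul (g h : QuaternionGroup p) : v (g * h) = (if e h then - v g else v g) + v h := by
  rcases g with i | i <;> rcases h with j | j <;> simp [v, e] <;> ring

lemma e_mul (g h : QuaternionGroup p) : e (g * h) = xor (e g) (e h) := by
  rcases g with i | i <;> rcases h with j | j <;> rfl

lemma dd (i : ZMod (2 * p)) : d i + d i = 0 := by
  obtain ⟨k, rfl⟩ := ZMod.intCast_surjective i
  rw [d_int, ← two_mul, ← mul_assoc]
  have : (2 : ZMod 4) * 2 = 0 := by decide
  simp [this]

lemma d_p (hodd : Odd p) : d (p : ZMod (2 * p)) = 2 := by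
  have := d_int (p := p) (p : ℤ)
  push_cast at this
  rw [this]
  obtain ⟨k, hk⟩ := hodd
  have h2 : (2 : ZMod 4) * 2 = 0 := by decide
  rw [hk]; push_cast; linear_combination (k : ZMod 4) * h2

lemma t_mul (hodd : Odd p) (g h : QuaternionGroup p) : t (g * h) = t g + t h := by
  rcases g with i | i <;> rcases h with j | j <;>
    simp only [a_mul_a, a_mul_xa, xa_mul_a, xa_mul_xa, t, map_add, map_sub, d_p hodd]
  · linear_combination - dd i
  · ring
  · linear_combination - dd i

lemma t_one : t (1 : QuaternionGroup p) = 0 := by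
  show d 0 = 0
  simp
lemma e_one : e (1 : QuaternionGroup p) = false := rfl
lemma v_one : v (1 : QuaternionGroup p) = 0 := by
  show ZMod.castHom _ _ 0 = 0
  simp

lemma d_cases (i : ZMod (2 * p)) : d i = 0 ∨ d i = 2 := by
  have := dd i
  generalize d i = x at *
  revert x; decide

lemma t_A {g : QuaternionGroup p} (h : e g = false) : t g = 0 ∨ t g = 2 := by
  rcases g with i | i
  · exact d_cases i
  · simp [e] at h

lemma t_B {g : QuaternionGroup p} (h : e g = true) : t g = 1 ∨ t g = 3 := by
  rcases g with i | i
  · simp [e] at h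
  · rcases d_cases i with h | h <;> simp only [t, h]
    · left; decide
    · right; decide

lemma e_of_t {g h : QuaternionGroup p} (ht : t g = t h) : e g = e h := by
  cases hg : e g <;> cases hh : e h <;> try rfl
  · rcases t_A hg with h1 | h1 <;> rcases t_B hh with h2 | h2 <;> rw [h1, h2] at ht <;>
      exact absurd ht (by decide)
  · rcases t_B hg with h1 | h1 <;> rcases t_A hh with h2 | h2 <;> rw [h1, h2] at ht <;>
      exact absurd ht (by decide)

lemma d_v (hodd : Odd p) (i : ZMod (2 * p)) (h1 : d i = 0)
    (h2 : ZMod.castHom (Dvd.intro_left 2 rfl : p ∣ 2 * p) (ZMod p) i = 0) : i = 0 := by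
  obtain ⟨k, rfl⟩ := ZMod.intCast_surjective i
  rw [d_int] at h1
  rw [map_intCast] at h2
  rw [ZMod.intCast_zmod_eq_zero_iff_dvd] at h2 ⊢
  have h3 : (((2 * k : ℤ)) : ZMod 4) = 0 := by push_cast; exact h1
  have h3 := (ZMod.intCast_zmod_eq_zero_iff_dvd (2 * k) 4).1 h3
  have h4 : (2 : ℤ) ∣ k := by push_cast at h3; omega
  push_cast
  refine IsCoprime.mul_dvd ?_ h4 h2
  rw [← Nat.cast_ofNat, Nat.isCoprime_iff_coprime]
  exact (Nat.coprime_two_left).2 hodd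

lemma vt_inj (hodd : Odd p) {g h : QuaternionGroup p} (hv : v g = v h) (ht : t g = t h) :
    g = h := by
  have he := e_of_t ht
  rcases g with i | i <;> rcases h with j | j <;> simp [e] at he
  · congr 1
    rw [← sub_eq_zero]
    refine d_v hodd _ ?_ ?_
    · simp only [t] at ht; rw [map_sub, ht, sub_self]
    · simp only [v] at hv; rw [map_sub, hv, sub_self]
  · congr 1
    rw [← sub_eq_zero]
    refine d_v hodd _ ?_ ?_
    · simp only [t] at ht; rw [map_sub, add_left_cancel ht, sub_self]
    · simp only [v] at hv; rw [map_sub, hv, sub_self]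

lemma t_list (hodd : Odd p) (l : List (QuaternionGroup p)) : t l.prod = (l.map t).sum := by
  induction l with
  | nil => simpa using t_one
  | cons g l ih => simp [t_mul hodd, ih]

/-- values of even arrangements -/
def Y (R : Multiset (QuaternionGroup p)) : Set (ZMod p) :=
  {y | ∃ l : List (QuaternionGroup p), (l : Multiset (QuaternionGroup p)) = R ∧
    e l.prod = false ∧ v l.prod = y}

lemma po_of (hodd : Odd p) {R : Multiset (QuaternionGroup p)} (h1 : (R.map t).sum = 0)
    (h2 : (0 : ZMod p) ∈ Y R) : IsProductOne R := by
  obtain ⟨l, rfl, hl, hv⟩ := h2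
  refine ⟨l, rfl, vt_inj hodd ?_ ?_⟩
  · rw [hv, v_one]
  · rw [t_list hodd, t_one]; simpa using h1

lemma po_t (hodd : Odd p) {R : Multiset (QuaternionGroup p)} (h : IsProductOne R) :
    (R.map t).sum = 0 := by
  obtain ⟨l, rfl, hl⟩ := h
  have := t_list hodd l
  rw [hl, t_one] at this
  simpa using this.symm

lemma po_Y {R : Multiset (QuaternionGroup p)} (h : IsProductOne R) : (0 : ZMod p) ∈ Y R := by
  obtain ⟨l, rfl, hl⟩ := h
  exact ⟨l, rfl, by rw [hl]; rfl, by rw [hl, v_one]⟩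

lemma Y_ne (hodd : Odd p) {R : Multiset (QuaternionGroup p)} (h1 : (R.map t).sum = 0) :
    (Y R).Nonempty := by
  induction R using Quotient.inductionOn with
  | h l =>
    refine ⟨v l.prod, l, rfl, ?_, rfl⟩
    rw [← e_one (p := p)]
    apply e_of_t
    rw [t_list hodd, t_one]; simpa using h1

lemma Y_zero : (0 : ZMod p) ∈ Y (0 : Multiset (QuaternionGroup p)) :=
  ⟨[], rfl, rfl, by simpa using v_one⟩

lemma Y_addA {R : Multiset (QuaternionGroup p)} {g : QuaternionGroup p} (hg : e g = false)
    {y : ZMod p} (hy : y ∈ Y R) : y + v g ∈ Y (g ::ₘ R) := by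
  obtain ⟨l, rfl, hl, rfl⟩ := hy
  refine ⟨l ++ [g], ?_, ?_, ?_⟩
  · exact Quotient.sound (List.perm_append_singleton g l)
  · simp [e_mul, hl, hg]
  · simp [v_mul, hg]

lemma Y_subA {R : Multiset (QuaternionGroup p)} {g : QuaternionGroup p} (hg : e g = false)
    (hB : ∃ b ∈ R, e b = true)
    {y : ZMod p} (hy : y ∈ Y R) : y - v g ∈ Y (g ::ₘ R) := by
  obtain ⟨l, rfl, hl, rfl⟩ := hy
  obtain ⟨b, hb, heb⟩ := hB
  obtain ⟨l1, l2, rfl⟩ := List.append_of_mem (Multiset.mem_coe.1 hb)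
  cases h2 : e l2.prod
  · refine ⟨l1 ++ g :: b :: l2, ?_, ?_, ?_⟩
    · exact Quotient.sound List.perm_middle
    · simpa [e_mul, hg] using hl
    · simp [v_mul, hg, h2, heb, e_mul]; ring
  · refine ⟨l1 ++ b :: g :: l2, ?_, ?_, ?_⟩
    · apply Quotient.sound
      refine (List.Perm.append_left l1 (List.Perm.swap g b l2)).trans List.perm_middle
    · simpa [e_mul, hg] using hl
    · simp [v_mul, hg, h2, heb, e_mul]; ring

lemma Y_pair {R : Multiset (QuaternionGroup p)} {b c : QuaternionGroup p} (hb : e b = true)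
    (hc : e c = true) {y : ZMod p} (hy : y ∈ Y R) : y + (v b - v c) ∈ Y (b ::ₘ c ::ₘ R) := by
  obtain ⟨l, rfl, hl, rfl⟩ := hy
  refine ⟨l ++ [c, b], ?_, ?_, ?_⟩
  · apply Quotient.sound
    refine (List.perm_append_comm).trans (List.Perm.swap _ _ _)
  · simp [e_mul, hl, hb, hc]
  · simp [v_mul, e_mul, hb, hc]; ring

lemma Y_del {R : Multiset (QuaternionGroup p)} {g : QuaternionGroup p} (hg : e g = false)
    (hv : v g = 0) {y : ZMod p} (hy : y ∈ Y (g ::ₘ R)) : y ∈ Y R := by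
  obtain ⟨l, hlR, hl, rfl⟩ := hy
  have hb : g ∈ l := by rw [← Multiset.mem_coe, hlR]; simp
  obtain ⟨l1, l2, rfl⟩ := List.append_of_mem hb
  refine ⟨l1 ++ l2, ?_, ?_, ?_⟩
  · have : ((l1 ++ g :: l2 : List _) : Multiset (QuaternionGroup p)) = g ::ₘ ((l1 ++ l2 : List _)) :=
      Quotient.sound List.perm_middle
    rw [this] at hlR
    exact (Multiset.cons_inj_right g).1 hlR
  · simpa [e_mul, hg] using hl
  · simp [v_mul, hg, hv, e_mul]

lemma cd (hp : p.Prime) (hodd : Odd p) {Y0 Y1 : Set (ZMod p)} (h0 : Y0.Nonempty) {x : ZMod p}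
    (hx : x ≠ 0) (h : ∀ y ∈ Y0, y + x ∈ Y1 ∧ y - x ∈ Y1) : min p (Y0.ncard + 1) ≤ Y1.ncard := by
  classical
  have : Fact p.Prime := ⟨hp⟩
  have hx2 : x ≠ -x := by
    intro h
    have h2 : (2 : ZMod p) * x = 0 := by linear_combination h
    rcases mul_eq_zero.1 h2 with h3 | h3
    · have : ((2 : ℕ) : ZMod p) = 0 := by exact_mod_cast h3
      rw [ZMod.natCast_eq_zero_iff] at this
      have := (Nat.prime_dvd_prime_iff_eq hp Nat.prime_two).1 this
      subst this
      exact absurd hodd (by decide)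
    · exact hx h3
  have := ZMod.cauchy_davenport hp (s := Y0.toFinset) (t := {x, -x}) (by simpa using h0) (by simp)
  rw [Finset.card_pair hx2] at this
  refine le_trans ?_ (this.trans ?_)
  · rw [Set.ncard_eq_toFinset_card']; rfl
  · rw [Set.ncard_eq_toFinset_card']
    apply Finset.card_le_card
    intro y hy
    rw [Finset.mem_add] at hy
    obtain ⟨y1, h1, w, hw, rfl⟩ := hy
    rw [Set.mem_toFinset] at h1 ⊢
    simp only [Finset.mem_insert, Finset.mem_singleton] at hw
    rcases hw with rfl | rfl
    · exact (h _ h1).1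
    · rw [← sub_eq_add_neg]; exact (h _ h1).2

lemma Yadd (hp : p.Prime) (hodd : Odd p) {R : Multiset (QuaternionGroup p)}
    (hB : ∃ b ∈ R, e b = true) (hY : (Y R).Nonempty) (W : Multiset (QuaternionGroup p))
    (hW : ∀ g ∈ W, e g = false) :
    (Y (W + R)).Nonempty ∧
    min p ((Y R).ncard + (W.filter (fun g => v g ≠ 0)).card) ≤ (Y (W + R)).ncard := by
  have : Fact p.Prime := ⟨hp⟩
  induction W using Multiset.induction_on with
  | empty => simpa using hY
  | cons g W ih =>
    obtain ⟨h1, h2⟩ := ih (fun x hx => hW x (Multiset.mem_cons_of_mem hx))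
    have hg := hW g (Multiset.mem_cons_self _ _)
    rw [Multiset.cons_add]
    obtain ⟨y, hy⟩ := h1
    refine ⟨⟨_, Y_addA hg hy⟩, ?_⟩
    have hB' : ∃ b ∈ W + R, e b = true := by
      obtain ⟨b, hb, hb'⟩ := hB
      exact ⟨b, Multiset.mem_add.2 (Or.inr hb), hb'⟩
    by_cases hv : v g = 0
    · rw [Multiset.filter_cons_of_neg (p := fun g => v g ≠ 0) W (by simpa using hv)]
      refine h2.trans (Set.ncard_le_ncard ?_ (Set.toFinite _))
      intro y hy
      simpa [hv] using Y_addA hg hy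
    · rw [Multiset.filter_cons_of_pos (p := fun g => v g ≠ 0) W hv, Multiset.card_cons]
      have := cd hp hodd ⟨y, hy⟩ hv (fun y hy => ⟨Y_addA hg hy, Y_subA hg hB' hy⟩)
      omega

lemma Y_full (hp : p.Prime) {R : Multiset (QuaternionGroup p)} (h : p ≤ (Y R).ncard) :
    (0 : ZMod p) ∈ Y R := by
  have : Fact p.Prime := ⟨hp⟩
  have : Y R = Set.univ := by
    apply Set.eq_of_subset_of_ncard_le (Set.subset_univ _) _ (Set.toFinite _)
    rw [Set.ncard_univ, Nat.card_zmod]; exact h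
  rw [this]; trivial

/-- nonzero terms of the cyclic part -/
def star (R : Multiset (QuaternionGroup p)) : Multiset (QuaternionGroup p) :=
  R.filter (fun g => e g = false ∧ v g ≠ 0)

lemma star_add (R R' : Multiset (QuaternionGroup p)) : star (R + R') = star R + star R' := by
  simp [star]

lemma split_e (R : Multiset (QuaternionGroup p)) :
    R.filter (fun g => e g = false) + R.filter (fun g => e g = true) = R := by
  have := Multiset.filter_add_not (fun g => e g = false) R
  simpa using this

lemma tsum_A (W : Multiset (QuaternionGroup p)) (h : ∀ g ∈ W, e g = false) :
    (W.map t).sum = 0 ∨ (W.map t).sum = 2 := by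
  induction W using Multiset.induction_on with
  | empty => simp
  | cons g W ih =>
    rw [Multiset.map_cons, Multiset.sum_cons]
    have h1 := ih (fun x hx => h x (Multiset.mem_cons_of_mem hx))
    have h2 := t_A (h g (Multiset.mem_cons_self _ _))
    clear ih
    generalize (W.map t).sum = x at *
    generalize t g = y at *
    revert x y; decide

lemma even_Y (hodd : Odd p) {R : Multiset (QuaternionGroup p)}
    (h1 : (R.map t).sum = 0 ∨ (R.map t).sum = 2) : (Y R).Nonempty := by
  induction R using Quotient.inductionOn with
  | h l =>
    refine ⟨v l.prod, l, rfl, ?_, rfl⟩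
    have h2 : t l.prod = 0 ∨ t l.prod = 2 := by rw [t_list hodd]; simpa using h1
    by_contra h
    rw [Bool.not_eq_false] at h
    have := t_B h
    generalize t l.prod = x at *
    revert x; decide

lemma reach (hp : p.Prime) (hodd : Odd p) {R : Multiset (QuaternionGroup p)}
    (ht : (R.map t).sum = 0) (hB : ∃ b ∈ R, e b = true) (hc : p - 1 ≤ (star R).card) :
    IsProductOne R := by
  have : Fact p.Prime := ⟨hp⟩
  apply po_of hodd ht
  apply Y_full hp
  have hs := split_e R
  have hBY : (Y (R.filter (fun g => e g = true))).Nonempty := by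
    apply even_Y hodd
    have h2 := tsum_A (R.filter (fun g => e g = false)) (by simp)
    rw [← hs, Multiset.map_add, Multiset.sum_add] at ht
    generalize ((R.filter (fun g => e g = false)).map t).sum = x at *
    generalize ((R.filter (fun g => e g = true)).map t).sum = y at *
    revert x y; decide
  have := (Yadd hp hodd (R := R.filter (fun g => e g = true)) (by simpa using hB) hBY
    (R.filter (fun g => e g = false)) (by simp)).2
  rw [hs] at this
  refine le_trans ?_ this
  have h1 : 1 ≤ (Y (R.filter (fun g => e g = true))).ncard :=
    (Set.ncard_pos (Set.toFinite _)).2 hBY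
  have h2 : (Multiset.filter (fun g => v g ≠ 0) (R.filter (fun g => e g = false))) = star R := by
    rw [Multiset.filter_filter, star]; congr 1; ext g; tauto
  rw [h2]
  omega

/-- number of terms outside the cyclic part -/
def nB (R : Multiset (QuaternionGroup p)) : ℕ := (R.filter (fun g => e g = true)).card

lemma nec (l : List (QuaternionGroup p)) : ∃ X X' : Multiset (QuaternionGroup p),
    X + X' = l ∧ (X.map v).sum - (X'.map v).sum = v l.prod ∧
    nB X = nB X' + (if e l.prod then 1 else 0) := by
  induction l using List.reverseRecOn with
  | nil => exact ⟨0, 0, rfl, by simpa using v_one.symm, by simp [e_one]⟩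
  | append_singleton l g ih =>
    obtain ⟨X, X', h1, h2, h3⟩ := ih
    cases hg : e g
    · refine ⟨g ::ₘ X, X', ?_, ?_, ?_⟩
      · rw [Multiset.cons_add, h1]
        exact Quotient.sound (List.perm_append_singleton g l).symm
      · simp [v_mul, hg, ← h2]; ring
      · simp [e_mul, hg, nB] at h3 ⊢; exact h3
    · refine ⟨g ::ₘ X', X, ?_, ?_, ?_⟩
      · rw [Multiset.cons_add, add_comm, h1]
        exact Quotient.sound (List.perm_append_singleton g l).symm
      · simp [v_mul, hg, ← h2]; ring
      · cases hl : e l.prod <;> simp [e_mul, hg, nB, hl] at h3 ⊢ <;> omega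

lemma convB (n : ℕ) : ∀ (P M : Multiset (QuaternionGroup p)), (∀ g ∈ P, e g = true) →
    (∀ g ∈ M, e g = true) → P.card = n → M.card = n →
    (P.map v).sum - (M.map v).sum ∈ Y (P + M) := by
  induction n with
  | zero =>
    intro P M _ _ h1 h2
    rw [Multiset.card_eq_zero] at h1 h2
    subst h1 h2
    simpa using Y_zero
  | succ n ih =>
    intro P M hP hM h1 h2
    obtain ⟨b, hb0⟩ := Multiset.card_pos_iff_exists_mem.1 (show 0 < P.card by omega)
    obtain ⟨P, rfl⟩ := Multiset.exists_cons_of_mem hb0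
    obtain ⟨c, hc0⟩ := Multiset.card_pos_iff_exists_mem.1 (show 0 < M.card by omega)
    obtain ⟨M, rfl⟩ := Multiset.exists_cons_of_mem hc0
    have := ih P M (fun g hg => hP g (Multiset.mem_cons_of_mem hg))
      (fun g hg => hM g (Multiset.mem_cons_of_mem hg)) (by simpa using h1) (by simpa using h2)
    have := Y_pair (hP b (Multiset.mem_cons_self _ _)) (hM c (Multiset.mem_cons_self _ _)) this
    rw [Multiset.cons_add, Multiset.add_cons]
    convert this using 1
    simp; ring

lemma conv (X X' : Multiset (QuaternionGroup p)) (h : nB X = nB X') (h0 : 0 < nB X) :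
    (X.map v).sum - (X'.map v).sum ∈ Y (X + X') := by
  have key : ∀ (U V R : Multiset (QuaternionGroup p)), (∃ b ∈ R, e b = true) →
      (∀ g ∈ U, e g = false) → (∀ g ∈ V, e g = false) → ∀ y ∈ Y R,
      y + (U.map v).sum - (V.map v).sum ∈ Y (U + V + R) := by
    intro U V R hR hU hV y hy
    induction U using Multiset.induction_on with
    | empty =>
      induction V using Multiset.induction_on with
      | empty => simpa using hy
      | cons g V ih =>
        have := ih (fun x hx => hV x (Multiset.mem_cons_of_mem hx))
        have := Y_subA (hV g (Multiset.mem_cons_self _ _))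
          (by obtain ⟨b, hb, hb'⟩ := hR; exact ⟨b, Multiset.mem_add.2 (Or.inr hb), hb'⟩) this
        rw [Multiset.add_cons, Multiset.cons_add]
        convert this using 1
        simp; ring
    | cons g U ih =>
      have := ih (fun x hx => hU x (Multiset.mem_cons_of_mem hx))
      have := Y_addA (hU g (Multiset.mem_cons_self _ _)) this
      rw [Multiset.cons_add, Multiset.cons_add]
      convert this using 1
      simp; ring
  have h1 := convB (nB X) (X.filter (fun g => e g = true)) (X'.filter (fun g => e g = true))
    (by simp) (by simp) rfl h.symm
  have h2 := key (X.filter (fun g => e g = false)) (X'.filter (fun g => e g = false)) _ (by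
    obtain ⟨b, hb⟩ := Multiset.card_pos_iff_exists_mem.1 h0
    exact ⟨b, Multiset.mem_add.2 (Or.inl hb), (Multiset.mem_filter.1 hb).2⟩) (by simp) (by simp) _ h1
  have hX := split_e X
  have hX' := split_e X'
  rw [add_add_add_comm, hX, hX'] at h2
  convert h2 using 1
  conv_lhs => rw [← hX, ← hX']
  simp only [Multiset.map_add, Multiset.sum_add]
  ring

lemma D0 (hp : p.Prime) (hodd : Odd p) (n : ℕ) : ∀ (R P M : Multiset (QuaternionGroup p)),
    (∀ g ∈ P, e g = true) → (∀ g ∈ M, e g = true) → P.card = n → M.card = n → (Y R).Nonempty →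
    (∀ b ∈ P, ∀ c ∈ M, v b ≠ v c) →
    min p ((Y R).ncard + n) ≤ (Y (P + M + R)).ncard := by
  have : Fact p.Prime := ⟨hp⟩
  induction n with
  | zero =>
    intro R P M _ _ h1 h2 _ _
    rw [Multiset.card_eq_zero] at h1 h2
    subst h1 h2
    simp
  | succ n ih =>
    intro R P M hP hM h1 h2 hR hne
    obtain ⟨b, hb0⟩ := Multiset.card_pos_iff_exists_mem.1 (show 0 < P.card by omega)
    obtain ⟨P, rfl⟩ := Multiset.exists_cons_of_mem hb0
    obtain ⟨c, hc0⟩ := Multiset.card_pos_iff_exists_mem.1 (show 0 < M.card by omega)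
    obtain ⟨M, rfl⟩ := Multiset.exists_cons_of_mem hc0
    have hb := hP b (Multiset.mem_cons_self _ _)
    have hc := hM c (Multiset.mem_cons_self _ _)
    have h3 : min p ((Y R).ncard + 1) ≤ (Y (b ::ₘ c ::ₘ R)).ncard := by
      refine cd hp hodd hR (sub_ne_zero.2 (hne b (Multiset.mem_cons_self _ _) c
        (Multiset.mem_cons_self _ _))) (fun y hy => ⟨Y_pair hb hc hy, ?_⟩)
      rw [Multiset.cons_swap]
      have := Y_pair hc hb hy
      convert this using 1; ring
    have := ih (b ::ₘ c ::ₘ R) P M (fun g hg => hP g (Multiset.mem_cons_of_mem hg))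
      (fun g hg => hM g (Multiset.mem_cons_of_mem hg)) (by simpa using h1) (by simpa using h2)
      (by obtain ⟨y, hy⟩ := hR; exact ⟨_, Y_pair hb hc hy⟩)
      (fun b hb c hc => hne b (Multiset.mem_cons_of_mem hb) c (Multiset.mem_cons_of_mem hc))
    have h4 : b ::ₘ P + c ::ₘ M + R = P + M + (b ::ₘ c ::ₘ R) := by
      simp only [← Multiset.singleton_add]; abel
    rw [h4]
    omega

lemma D1 (hp : p.Prime) (hodd : Odd p) (n : ℕ) (R P M : Multiset (QuaternionGroup p))
    (hP : ∀ g ∈ P, e g = true) (hM : ∀ g ∈ M, e g = true) (h1 : P.card = n) (h2 : M.card = n)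
    (hR : (Y R).Nonempty)
    (hne : ∀ b₁ b₂ c₁ c₂, {b₁, b₂} ≤ P → {c₁, c₂} ≤ M → v b₁ = v c₁ → v b₂ = v c₂ → False) :
    min p ((Y R).ncard + (n - 1)) ≤ (Y (P + M + R)).ncard := by
  have : Fact p.Prime := ⟨hp⟩
  by_cases h : ∃ b ∈ P, ∃ c ∈ M, v b = v c
  · obtain ⟨b, hb, c, hc, hbc⟩ := h
    obtain ⟨P, rfl⟩ := Multiset.exists_cons_of_mem hb
    obtain ⟨M, rfl⟩ := Multiset.exists_cons_of_mem hc
    have hb := hP b (Multiset.mem_cons_self _ _)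
    have hc := hM c (Multiset.mem_cons_self _ _)
    have h4 : b ::ₘ P + c ::ₘ M + R = P + M + (b ::ₘ c ::ₘ R) := by
      simp only [← Multiset.singleton_add]; abel
    have h3 : (Y R).ncard ≤ (Y (b ::ₘ c ::ₘ R)).ncard := by
      apply Set.ncard_le_ncard _ (Set.toFinite _)
      intro y hy
      simpa [hbc] using Y_pair hb hc hy
    have := D0 hp hodd (n - 1) (b ::ₘ c ::ₘ R) P M (fun g hg => hP g (Multiset.mem_cons_of_mem hg))
      (fun g hg => hM g (Multiset.mem_cons_of_mem hg)) (by simp at h1; omega) (by simp at h2; omega)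
      (by obtain ⟨y, hy⟩ := hR; exact ⟨_, Y_pair hb hc hy⟩)
      (fun b' hb' c' hc' hh => hne b b' c c' (by
        rw [Multiset.insert_eq_cons]
        exact Multiset.cons_le_cons _ (Multiset.singleton_le.2 hb')) (by
        rw [Multiset.insert_eq_cons]
        exact Multiset.cons_le_cons _ (Multiset.singleton_le.2 hc')) hbc hh)
    rw [h4]
    omega
  · push Not at h
    have := D0 hp hodd n R P M hP hM h1 h2 hR h
    omega

lemma pig (hp : p.Prime) {P : Multiset (QuaternionGroup p)} (h : p < P.card) :
    ∃ b c, {b, c} ≤ P ∧ v b = v c := by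
  have : Fact p.Prime := ⟨hp⟩
  have : ¬ (P.map v).Nodup := by
    intro hn
    have h1 := Finset.card_le_univ (⟨_, hn⟩ : Finset (ZMod p))
    rw [ZMod.card, Finset.card_mk, Multiset.card_map] at h1
    omega
  rw [Multiset.nodup_iff_le] at this
  push Not at this
  obtain ⟨x, hx⟩ := this
  have hx1 : x ∈ P.map v := Multiset.mem_of_le hx (Multiset.mem_cons_self _ _)
  obtain ⟨b, hb, rfl⟩ := Multiset.mem_map.1 hx1
  obtain ⟨P, rfl⟩ := Multiset.exists_cons_of_mem hb
  rw [Multiset.map_cons, Multiset.cons_le_cons_iff] at hx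
  replace hx := Multiset.singleton_le.1 hx
  obtain ⟨c, hc, hcb⟩ := Multiset.mem_map.1 hx
  exact ⟨b, c, by
        rw [Multiset.insert_eq_cons]
        exact Multiset.cons_le_cons _ (Multiset.singleton_le.2 hc), hcb.symm⟩

lemma tB0 {b c : QuaternionGroup p} (hb : e b = true) (hc : e c = true) :
    t b + t c = 0 ∨ t b + t c = 2 := by
  have h1 := t_B hb
  have h2 := t_B hc
  generalize t b = x at *
  generalize t c = y at *
  revert x y; decide

lemma po2 (hodd : Odd p) {b c : QuaternionGroup p} (hb : e b = true) (hc : e c = true)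
    (hv : v b = v c) (ht : t b + t c = 0) : IsProductOne ({b, c} : Multiset (QuaternionGroup p)) := by
  apply po_of hodd
  · simpa using ht
  · simpa [hv] using Y_pair hb hc Y_zero

lemma po4 (hodd : Odd p) {b c b' c' : QuaternionGroup p} (hb : e b = true) (hc : e c = true)
    (hb' : e b' = true) (hc' : e c' = true)
    (hv : v b = v c) (hv' : v b' = v c') (ht : t b + t c = 2) (ht' : t b' + t c' = 2) :
    IsProductOne ({b, c} + {b', c'} : Multiset (QuaternionGroup p)) := by
  apply po_of hodd
  · simp only [Multiset.map_add, Multiset.sum_add, Multiset.insert_eq_cons, Multiset.map_cons,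
      Multiset.map_singleton, Multiset.sum_cons, Multiset.sum_singleton, ht, ht']
    decide
  · have h := Y_pair hb hc (Y_pair hb' hc' Y_zero)
    rw [hv, hv', sub_self, sub_self, add_zero, add_zero] at h
    exact h

lemma pref {H : Type*} [Fintype H] (f : QuaternionGroup p → H) (q : QuaternionGroup p → Prop)
    (h1 : q 1) (hm : ∀ g h, q g → q h → q (g * h)) (hf : ∀ g h, q g → q h → f g = f h → g = h)
    (W : Multiset (QuaternionGroup p)) (hW : ∀ g ∈ W, q g) (hc : Fintype.card H ≤ W.card) :
    ∃ T ≤ W, T ≠ 0 ∧ IsProductOne T := by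
  induction W using Quotient.inductionOn with
  | h l =>
  have hq : ∀ i, q (l.take i).prod := by
    intro i
    have : ∀ l' : List (QuaternionGroup p), (∀ g ∈ l', q g) → q l'.prod := by
      intro l' h
      induction l' with
      | nil => simpa using h1
      | cons g l' ih =>
        rw [List.prod_cons]
        exact hm _ _ (h g (by simp)) (ih (fun x hx => h x (by simp [hx])))
    exact this _ (fun g hg => hW g (by simpa using List.mem_of_mem_take hg))
  have hc' : Fintype.card H ≤ l.length := by simpa using hc
  obtain ⟨i, j, hij, hfij⟩ := Fintype.exists_ne_map_eq_of_card_lt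
    (fun i : Fin (l.length + 1) => f (l.take i).prod) (by simp; omega)
  have hfin : ∀ i j : Fin (l.length + 1), i < j → (l.take i).prod = (l.take j).prod →
      ∃ T ≤ (l : Multiset (QuaternionGroup p)), T ≠ 0 ∧ IsProductOne T := by
    intro i j hlt heq
    refine ⟨((l.take j).drop i : List _), ?_, ?_, ⟨_, rfl, ?_⟩⟩
    · exact Multiset.coe_le.2 (((List.drop_sublist _ _).trans (List.take_sublist _ _)).subperm)
    · rw [← Multiset.card_pos, Multiset.coe_card, List.length_drop, List.length_take]
      have := j.2; omega
    · have h2 : (l.take j).prod = ((l.take j).take i).prod * ((l.take j).drop i).prod := by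
        rw [← List.prod_append, List.take_append_drop]
      rw [List.take_take, min_eq_left (show (i : ℕ) ≤ j from hlt.le), ← heq] at h2
      exact (left_eq_mul.1 h2)
  have heq := hf _ _ (hq _) (hq _) hfij
  rcases lt_or_gt_of_ne hij with h | h
  · exact hfin i j h heq
  · exact hfin j i h heq.symm

end QD
end
section
namespace QD
open QuaternionGroup
variable {p : ℕ}

lemma sub_card {α : Type*} {S : Multiset α} {n : ℕ} (h : n ≤ S.card) :
    ∃ W U : Multiset α, S = W + U ∧ W.card = n := by
  induction S using Quotient.inductionOn with
  | h l =>
    refine ⟨(l.take n : List _), (l.drop n : List _), ?_, ?_⟩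
    · rw [Multiset.coe_add, List.take_append_drop]; rfl
    · simpa using h

lemma vA (l : List (QuaternionGroup p)) (h : ∀ g ∈ l, e g = false) :
    e l.prod = false ∧ v l.prod = (l.map v).sum := by
  induction l with
  | nil => exact ⟨rfl, by simpa using v_one⟩
  | cons g l ih =>
    obtain ⟨h1, h2⟩ := ih (fun x hx => h x (by simp [hx]))
    have hg := h g (by simp)
    simp [e_mul, v_mul, h1, h2, hg]

lemma vA_Y {R : Multiset (QuaternionGroup p)} (h : ∀ g ∈ R, e g = false) :
    (R.map v).sum ∈ Y R := by
  induction R using Quotient.inductionOn with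
  | h l =>
    obtain ⟨h1, h2⟩ := vA l (by simpa using h)
    exact ⟨l, rfl, h1, by rw [h2]; simp⟩

lemma vA_Y' {R : Multiset (QuaternionGroup p)} (h : ∀ g ∈ R, e g = false) {y : ZMod p}
    (hy : y ∈ Y R) : y = (R.map v).sum := by
  obtain ⟨l, rfl, h1, rfl⟩ := hy
  obtain ⟨_, h2⟩ := vA l (by simpa using h)
  rw [h2]; simp

lemma prefA (hp : p.Prime) (hodd : Odd p) (W : Multiset (QuaternionGroup p))
    (hW : ∀ g ∈ W, e g = false) (hc : 2 * p ≤ W.card) :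
    ∃ T ≤ W, T ≠ 0 ∧ IsProductOne T := by
  have : Fact p.Prime := ⟨hp⟩
  refine pref (fun g => (v g, decide (t g = 0))) (fun g => e g = false) e_one ?_ ?_ W hW ?_
  · intro g h hg hh; simp [e_mul, hg, hh]
  · intro g h hg hh hgh
    simp only [Prod.mk.injEq, decide_eq_decide] at hgh
    refine vt_inj hodd hgh.1 ?_
    rcases t_A hg with h1 | h1 <;> rcases t_A hh with h2 | h2 <;> simp_all
  · rw [Fintype.card_prod, ZMod.card, Fintype.card_bool]; omega

lemma prefA0 (hp : p.Prime) (hodd : Odd p) (W : Multiset (QuaternionGroup p))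
    (hW : ∀ g ∈ W, t g = 0) (hc : p ≤ W.card) :
    ∃ T ≤ W, T ≠ 0 ∧ IsProductOne T := by
  have : Fact p.Prime := ⟨hp⟩
  refine pref (fun g => v g) (fun g => t g = 0) t_one ?_ ?_ W hW ?_
  · intro g h hg hh; simp [t_mul hodd, hg, hh]
  · intro g h hg hh hgh
    exact vt_inj hodd hgh (hg.trans hh.symm)
  · rw [ZMod.card]; omega

lemma star_B {T : Multiset (QuaternionGroup p)} (h : ∀ g ∈ T, e g = true) : star T = 0 := by
  rw [star, Multiset.filter_eq_nil]
  intro g hg; simp [h g hg]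

lemma star_A {T : Multiset (QuaternionGroup p)} (h : ∀ g ∈ T, e g = false ∧ v g ≠ 0) :
    star T = T := Multiset.filter_eq_self.2 h

lemma nB_add (R R' : Multiset (QuaternionGroup p)) : nB (R + R') = nB R + nB R' := by
  simp [nB]

lemma nB_B {T : Multiset (QuaternionGroup p)} (h : ∀ g ∈ T, e g = true) : nB T = T.card := by
  rw [nB, Multiset.filter_eq_self.2 h]

lemma main (hp : p.Prime) (hodd : Odd p) (S : Multiset (QuaternionGroup p))
    (hS : IsProductOne S)
    (hmin : ∀ T R, S = T + R → T ≠ 0 → R ≠ 0 → IsProductOne T → IsProductOne R → False)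
    (hc : 3 * p + 1 ≤ S.card) : False := by
  have : Fact p.Prime := ⟨hp⟩
  have hp3 : 3 ≤ p := by
    have := hp.two_le
    obtain ⟨k, hk⟩ := hodd
    omega
  have htS := po_t hodd hS
  have htR : ∀ T R, S = T + R → IsProductOne T → (R.map t).sum = 0 := by
    intro T R h hT
    have h1 := po_t hodd hT
    rw [h, Multiset.map_add, Multiset.sum_add, h1, zero_add] at htS
    exact htS
  have kill : ∀ T R, S = T + R → T ≠ 0 → IsProductOne T → (∃ b ∈ R, e b = true) →
      p - 1 ≤ (star R).card → False := by
    intro T R h hT0 hT hb hc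
    refine hmin T R h hT0 ?_ hT (reach hp hodd (htR T R h hT) hb hc)
    rintro rfl
    obtain ⟨b, hb, _⟩ := hb
    simp at hb
  obtain ⟨A, hA⟩ : ∃ A, A = S.filter (fun g => e g = false) := ⟨_, rfl⟩
  obtain ⟨B, hB⟩ : ∃ B, B = S.filter (fun g => e g = true) := ⟨_, rfl⟩
  have hAB : A + B = S := by rw [hA, hB]; exact split_e S
  have hAe : ∀ g ∈ A, e g = false := by rw [hA]; simp
  have hBe : ∀ g ∈ B, e g = true := by rw [hB]; simp
  have hcard : A.card + B.card = S.card := by rw [← hAB, Multiset.card_add]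
  -- case B empty
  by_cases hB0 : B = 0
  · rw [hB0, add_zero] at hAB
    rw [hAB] at hAe
    obtain ⟨W, U, hWU, hW⟩ := sub_card (show 2 * p ≤ S.card by omega)
    obtain ⟨T, hTW, hT0, hT⟩ := prefA hp hodd W
      (fun g hg => hAe g (by rw [hWU]; exact Multiset.mem_add.2 (Or.inl hg))) hW.ge
    obtain ⟨V, rfl⟩ := Multiset.le_iff_exists_add.1 hTW
    have hST : S = T + (V + U) := by rw [hWU, add_assoc]
    have hTe : ∀ g ∈ T, e g = false :=
      fun g hg => hAe g (by rw [hST]; exact Multiset.mem_add.2 (Or.inl hg))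
    have hRe : ∀ g ∈ V + U, e g = false :=
      fun g hg => hAe g (by rw [hST]; exact Multiset.mem_add.2 (Or.inr hg))
    refine hmin T (V + U) hST hT0 ?_ hT ?_
    · intro h
      have h1 := congrArg Multiset.card h
      have h2 := congrArg Multiset.card hWU
      simp only [Multiset.card_add, Multiset.card_zero] at h1 h2 hW
      omega
    · apply po_of hodd (htR _ _ hST hT)
      have h1 := vA_Y' hAe (po_Y hS)
      have h2 := vA_Y' hTe (po_Y hT)
      rw [hST, Multiset.map_add, Multiset.sum_add, ← h2, zero_add] at h1
      rw [h1]
      exact vA_Y hRe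
  have hBex : ∃ b ∈ B, e b = true := by
    obtain ⟨b, hb⟩ := Multiset.exists_mem_of_ne_zero hB0
    exact ⟨b, hb, hBe b hb⟩
  -- zeros
  obtain ⟨Z, hZ⟩ : ∃ Z, Z = A.filter (fun g => v g = 0) := ⟨_, rfl⟩
  obtain ⟨As, hAs⟩ : ∃ As, As = A.filter (fun g => ¬ v g = 0) := ⟨_, rfl⟩
  have hZA : Z + As = A := by rw [hZ, hAs]; exact Multiset.filter_add_not _ _
  have hZc : Z.card + As.card = A.card := by rw [← hZA, Multiset.card_add]
  have hAse : ∀ g ∈ As, e g = false ∧ v g ≠ 0 := by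
    intro g hg
    rw [hAs, Multiset.mem_filter] at hg
    exact ⟨hAe g hg.1, hg.2⟩
  have hZe : ∀ g ∈ Z, e g = false ∧ v g = 0 := by
    intro g hg
    rw [hZ, Multiset.mem_filter] at hg
    exact ⟨hAe g hg.1, hg.2⟩
  have hstarZ : star Z = 0 := by
    rw [star, Multiset.filter_eq_nil]
    intro g hg; simp [(hZe g hg).2]
  have hstarA : star A = As := by rw [← hZA, star_add, hstarZ, star_A hAse, zero_add]
  have hstarS : star S = As := by rw [← hAB, star_add, hstarA, star_B hBe, add_zero]
  have hZ2 : ∀ g ∈ Z, t g = 2 := by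
    intro g hg
    obtain ⟨h1, h2⟩ := hZe g hg
    rcases t_A h1 with h3 | h3
    · exfalso
      have hgS : g ∈ S := by
        rw [← hAB, ← hZA]; simp [hg]
      obtain ⟨R, hR⟩ := Multiset.exists_cons_of_mem hgS
      have hT : IsProductOne ({g} : Multiset (QuaternionGroup p)) :=
        po_of hodd (by simpa using h3) (by
          have := Y_addA h1 (Y_zero (p := p))
          rw [h2, add_zero] at this; exact this)
      have hSR : S = {g} + R := by rw [hR, Multiset.singleton_add]
      refine hmin {g} R hSR (by simp) ?_ hT (po_of hodd (htR _ _ hSR hT) ?_)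
      · rintro rfl
        rw [hSR] at hc
        simp at hc
        omega
      · have := po_Y hS
        rw [hR] at this
        exact Y_del h1 h2 this
    · exact h3
  have hZ1 : Z.card ≤ 1 := by
    by_contra hlt
    obtain ⟨W, U, hWU, hW⟩ := sub_card (show 2 ≤ Z.card by omega)
    obtain ⟨g, g', rfl⟩ := Multiset.card_eq_two.1 hW
    have hg : g ∈ Z := by rw [hWU]; simp
    have hg' : g' ∈ Z := by rw [hWU]; simp
    have hSR : S = {g, g'} + (U + As + B) := by
      rw [← hAB, ← hZA, hWU]; abel
    have hT : IsProductOne ({g, g'} : Multiset (QuaternionGroup p)) :=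
      po_of hodd (by simp [hZ2 g hg, hZ2 g' hg']; decide) (by
        have := Y_addA (hZe g hg).1 (Y_addA (hZe g' hg').1 (Y_zero (p := p)))
        rw [(hZe g hg).2, (hZe g' hg').2, add_zero, add_zero] at this; exact this)
    refine hmin _ _ hSR (by simp) ?_ hT (po_of hodd (htR _ _ hSR hT) ?_)
    · intro h
      have h1 := congrArg Multiset.card hSR
      rw [h] at h1
      simp at h1
      omega
    · have := po_Y hS
      rw [hSR, Multiset.insert_eq_cons, Multiset.cons_add, Multiset.singleton_add] at this
      exact Y_del (hZe g' hg').1 (hZe g' hg').2 (Y_del (hZe g hg).1 (hZe g hg).2 this)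
  -- signing
  obtain ⟨X, X', hX1, hX2, hX3⟩ : ∃ X X' : Multiset (QuaternionGroup p), X + X' = S ∧
      (X.map v).sum = (X'.map v).sum ∧ nB X = nB X' := by
    obtain ⟨l, hl, hl1⟩ := hS
    obtain ⟨X, X', h1, h2, h3⟩ := nec l
    refine ⟨X, X', h1.trans hl, ?_, ?_⟩
    · rw [hl1, v_one, sub_eq_zero] at h2; exact h2
    · rw [hl1, e_one] at h3; simpa using h3
  have hBm : B.card = 2 * nB X := by
    have : B.card = nB S := by rw [hB, nB]
    rw [this, ← hX1, nB_add, ← hX3]; ring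
  have hBpos : 0 < B.card := Multiset.card_pos.2 hB0
  by_cases hm1 : nB X = 1
  · -- one pair
    obtain ⟨W1, U1, hWU, hW1⟩ := sub_card (show 2 * p - Z.card ≤ As.card by omega)
    obtain ⟨T, hTW, hT0, hT⟩ := prefA hp hodd (Z + W1) (by
      intro g hg
      rcases Multiset.mem_add.1 hg with h | h
      · exact (hZe g h).1
      · exact (hAse g (by rw [hWU]; exact Multiset.mem_add.2 (Or.inl h))).1) (by
        rw [Multiset.card_add]; omega)
    obtain ⟨V, hV⟩ := Multiset.le_iff_exists_add.1 hTW
    have hST : S = T + (V + U1 + B) := by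
      rw [← hAB, ← hZA, hWU, ← add_assoc Z, hV]; abel
    refine kill T _ hST hT0 hT ?_ ?_
    · obtain ⟨b, hb, hb'⟩ := hBex
      exact ⟨b, Multiset.mem_add.2 (Or.inr hb), hb'⟩
    · have h1 : U1.card + W1.card = As.card := by rw [hWU, Multiset.card_add, add_comm]
      rw [star_add, star_add, star_A (T := U1) (fun g hg => hAse g (by
        rw [hWU]; exact Multiset.mem_add.2 (Or.inr hg)))]
      simp only [Multiset.card_add]
      omega
  by_cases hst : As.card ≤ p - 2
  · -- case 1
    obtain ⟨P, hP⟩ : ∃ P, P = X.filter (fun g => e g = true) := ⟨_, rfl⟩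
    obtain ⟨M, hM⟩ : ∃ M, M = X'.filter (fun g => e g = true) := ⟨_, rfl⟩
    have hPX : P ≤ X := by rw [hP]; exact Multiset.filter_le _ _
    have hMX : M ≤ X' := by rw [hM]; exact Multiset.filter_le _ _
    have hPe : ∀ g ∈ P, e g = true := by rw [hP]; simp
    have hMe : ∀ g ∈ M, e g = true := by rw [hM]; simp
    have hPc : P.card = nB X := by rw [hP, nB]
    have hMc : M.card = nB X := by rw [hM, hX3, nB]
    have hPM : P + M = B := by rw [hB, ← hX1, hP, hM, Multiset.filter_add]
    have killX : ∀ T1 T2 X1 X2, X = T1 + X1 → X' = T2 + X2 → nB T1 = nB T2 →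
        (T1.map v).sum = (T2.map v).sum → T1 + T2 ≠ 0 → IsProductOne (T1 + T2) →
        nB T1 < nB X → False := by
      intro T1 T2 X1 X2 h1 h2 h3 h4 h5 h6 h7
      have hSR : S = (T1 + T2) + (X1 + X2) := by rw [← hX1, h1, h2]; abel
      have hn : nB X1 = nB X2 := by
        rw [h1, h2, nB_add, nB_add] at hX3; omega
      have hn0 : 0 < nB X1 := by
        rw [h1, nB_add] at h7; omega
      refine hmin _ _ hSR h5 ?_ h6 (po_of hodd (htR _ _ hSR h6) ?_)
      · intro h
        have h8 : nB (X1 + X2) = 0 := by rw [h]; simp [nB]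
        rw [nB_add] at h8; omega
      · have := conv X1 X2 hn hn0
        rw [h1, h2, Multiset.map_add, Multiset.map_add, Multiset.sum_add, Multiset.sum_add, h4] at hX2
        rwa [add_left_cancel hX2, sub_self] at this
    have hne : ∀ b₁ b₂ c₁ c₂, {b₁, b₂} ≤ P → {c₁, c₂} ≤ M → v b₁ = v c₁ → v b₂ = v c₂ → False := by
      intro b₁ b₂ c₁ c₂ hb hc h1 h2
      obtain ⟨X1, hXX⟩ := Multiset.le_iff_exists_add.1 (hb.trans hPX)
      obtain ⟨X2, hXX'⟩ := Multiset.le_iff_exists_add.1 (hc.trans hMX)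
      have eb1 := hPe b₁ (Multiset.mem_of_le hb (by simp))
      have eb2 := hPe b₂ (Multiset.mem_of_le hb (by simp))
      have ec1 := hMe c₁ (Multiset.mem_of_le hc (by simp))
      have ec2 := hMe c₂ (Multiset.mem_of_le hc (by simp))
      rcases tB0 eb1 ec1 with h3 | h3
      · refine killX {b₁} {c₁} ({b₂} + X1) ({c₂} + X2) ?_ ?_ ?_ ?_ ?_ (po2 hodd eb1 ec1 h1 h3) ?_
        · rw [hXX, ← add_assoc]; rfl
        · rw [hXX', ← add_assoc]; rfl
        · simp [nB, Multiset.filter_singleton, eb1, ec1]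
        · simpa using h1
        · simp
        · rw [nB_B (by simpa using eb1)]; simp; omega
      rcases tB0 eb2 ec2 with h4 | h4
      · refine killX {b₂} {c₂} ({b₁} + X1) ({c₁} + X2) ?_ ?_ ?_ ?_ ?_ (po2 hodd eb2 ec2 h2 h4) ?_
        · rw [hXX]; simp only [Multiset.insert_eq_cons, ← Multiset.singleton_add]; abel
        · rw [hXX']; simp only [Multiset.insert_eq_cons, ← Multiset.singleton_add]; abel
        · simp [nB, Multiset.filter_singleton, eb2, ec2]
        · simpa using h2
        · simp
        · rw [nB_B (by simpa using eb2)]; simp; omega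
      · have h5 := po4 hodd eb1 ec1 eb2 ec2 h1 h2 h3 h4
        have h6 : ({b₁, c₁} + {b₂, c₂} : Multiset (QuaternionGroup p)) = {b₁, b₂} + {c₁, c₂} := by
          simp only [Multiset.insert_eq_cons, ← Multiset.singleton_add]; abel
        rw [h6] at h5
        have n1 : nB {b₁, b₂} = 2 := by rw [nB_B (by simp [eb1, eb2])]; simp
        have n2 : nB {c₁, c₂} = 2 := by rw [nB_B (by simp [ec1, ec2])]; simp
        refine killX {b₁, b₂} {c₁, c₂} X1 X2 hXX hXX' (by rw [n1, n2]) (by simp [h1, h2]) (by simp)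
          h5 (by omega)
    obtain ⟨b₁, b₂, hb, hvb⟩ := pig hp (show p < P.card by omega)
    obtain ⟨c₁, c₂, hcc, hvc⟩ := pig hp (show p < M.card by omega)
    have eb1 := hPe b₁ (Multiset.mem_of_le hb (by simp))
    have eb2 := hPe b₂ (Multiset.mem_of_le hb (by simp))
    have ec1 := hMe c₁ (Multiset.mem_of_le hcc (by simp))
    have ec2 := hMe c₂ (Multiset.mem_of_le hcc (by simp))
    obtain ⟨P', hP'⟩ := Multiset.le_iff_exists_add.1 hb
    obtain ⟨M', hM'⟩ := Multiset.le_iff_exists_add.1 hcc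
    have hP'P : P' ≤ P := by rw [hP']; exact Multiset.le_add_left _ _
    have hM'M : M' ≤ M := by rw [hM']; exact Multiset.le_add_left _ _
    have hP'c : P'.card = nB X - 2 := by
      rw [hP'] at hPc; simp at hPc; omega
    have hM'c : M'.card = nB X - 2 := by
      rw [hM'] at hMc; simp at hMc; omega
    have fin : ∀ T R, T + R = {b₁, b₂} + {c₁, c₂} → T ≠ 0 → IsProductOne T → (Y R).Nonempty →
        False := by
      intro T R hTR hT0 hT hR
      have hSR : S = T + (A + (P' + M' + R)) := by
        rw [← hAB, ← hPM, hP', hM']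
        calc A + ({b₁, b₂} + P' + ({c₁, c₂} + M')) = A + P' + M' + ({b₁, b₂} + {c₁, c₂}) := by abel
          _ = A + P' + M' + (T + R) := by rw [hTR]
          _ = _ := by abel
      have h1 := D1 hp hodd _ R P' M' (fun g hg => hPe g (Multiset.mem_of_le hP'P hg))
        (fun g hg => hMe g (Multiset.mem_of_le hM'M hg)) hP'c hM'c hR
        (fun b b' c c' hb hc => hne b b' c c' (hb.trans hP'P) (hc.trans hM'M))
      have hRp : 0 < (Y R).ncard := (Set.ncard_pos (Set.toFinite _)).2 hR
      have hbP : ∃ b ∈ P' + M' + R, e b = true := by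
        obtain ⟨b, hb⟩ := Multiset.card_pos_iff_exists_mem.1 (show 0 < P'.card by omega)
        exact ⟨b, by simp [hb], hPe b (Multiset.mem_of_le hP'P hb)⟩
      have hne' : (Y (P' + M' + R)).Nonempty := by
        rw [← Set.ncard_pos (Set.toFinite _)]; omega
      have h2 := (Yadd hp hodd hbP hne' A hAe).2
      have h3 : (A.filter (fun g => v g ≠ 0)) = As := hAs.symm
      rw [h3] at h2
      refine hmin _ _ hSR hT0 ?_ hT (po_of hodd (htR _ _ hSR hT) (Y_full hp ?_))
      · intro h
        obtain ⟨b, hb, _⟩ := hbP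
        have : b ∈ A + (P' + M' + R) := Multiset.mem_add.2 (Or.inr hb)
        rw [h] at this; simp at this
      · omega
    rcases tB0 eb1 eb2 with h3 | h3
    · refine fin {b₁, b₂} {c₁, c₂} rfl (by simp) (po2 hodd eb1 eb2 hvb h3) (even_Y hodd ?_)
      simpa using tB0 ec1 ec2
    rcases tB0 ec1 ec2 with h4 | h4
    · refine fin {c₁, c₂} {b₁, b₂} (add_comm _ _) (by simp) (po2 hodd ec1 ec2 hvc h4) (even_Y hodd ?_)
      simpa using tB0 eb1 eb2
    · exact fin _ 0 (add_zero _) (by simp) (po4 hodd eb1 eb2 ec1 ec2 hvb hvc h3 h4) ⟨0, Y_zero⟩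
  by_cases hBp : p + 3 ≤ B.card
  · -- case 2
    obtain ⟨b₁, b₂, hb, hvb⟩ := pig hp (show p < B.card by omega)
    obtain ⟨B1, hB1⟩ := Multiset.le_iff_exists_add.1 hb
    have hB1c : B.card = 2 + B1.card := by rw [hB1]; simp; omega
    obtain ⟨c₁, c₂, hcc, hvc⟩ := pig hp (show p < B1.card by omega)
    obtain ⟨B2, hB2⟩ := Multiset.le_iff_exists_add.1 hcc
    have hB2c : B1.card = 2 + B2.card := by rw [hB2]; simp; omega
    have hBB : B = {b₁, b₂} + {c₁, c₂} + B2 := by rw [hB1, hB2, add_assoc]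
    have eb1 := hBe b₁ (by rw [hBB]; simp)
    have eb2 := hBe b₂ (by rw [hBB]; simp)
    have ec1 := hBe c₁ (by rw [hBB]; simp)
    have ec2 := hBe c₂ (by rw [hBB]; simp)
    obtain ⟨b, hb2⟩ := Multiset.card_pos_iff_exists_mem.1 (show 0 < B2.card by omega)
    have fin : ∀ T R, T + R = {b₁, b₂} + {c₁, c₂} → T ≠ 0 → IsProductOne T → False := by
      intro T R hTR hT0 hT
      have hSR : S = T + (A + (B2 + R)) := by
        rw [← hAB, hBB, ← hTR]; abel
      refine kill _ _ hSR hT0 hT ⟨b, by simp [hb2], hBe b (by rw [hBB]; simp [hb2])⟩ ?_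
      rw [star_add, hstarA, Multiset.card_add]
      omega
    rcases tB0 eb1 eb2 with h3 | h3
    · exact fin {b₁, b₂} {c₁, c₂} rfl (by simp) (po2 hodd eb1 eb2 hvb h3)
    rcases tB0 ec1 ec2 with h4 | h4
    · exact fin {c₁, c₂} {b₁, b₂} (add_comm _ _) (by simp) (po2 hodd ec1 ec2 hvc h4)
    · exact fin _ 0 (add_zero _) (by simp) (po4 hodd eb1 eb2 ec1 ec2 hvb hvc h3 h4)
  -- case 3
  have hA2 : 2 * p ≤ A.card := by
    obtain ⟨k, hk⟩ := hodd
    omega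
  by_cases hg : ∃ g ∈ A, t g = 2
  · obtain ⟨g, hgA, hg2⟩ := hg
    have hge := hAe g hgA
    obtain ⟨A1, hA1⟩ := Multiset.exists_cons_of_mem hgA
    rw [← Multiset.singleton_add] at hA1
    have hA1c : 2 * p - 2 ≤ (star A1).card := by
      have h1 : (star {g}).card ≤ 1 := by
        have := Multiset.card_le_card (Multiset.filter_le (fun g => e g = false ∧ v g ≠ 0) {g})
        simpa [star] using this
      have h2 : As.card = (star {g}).card + (star A1).card := by
        rw [← hstarA, hA1, star_add, Multiset.card_add]
      omega
    obtain ⟨A0, hA0⟩ := Multiset.le_iff_exists_add.1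
      (Multiset.filter_le (fun g => e g = false ∧ v g ≠ 0) A1)
    obtain ⟨W0, W2, hW, hW0⟩ := sub_card (show p - 1 ≤ (star A1).card by omega)
    have hW' : ∀ x ∈ star A1, e x = false ∧ v x ≠ 0 := by
      intro x hx; exact (Multiset.mem_filter.1 hx).2
    have hW0e : ∀ x ∈ W0, e x = false ∧ v x ≠ 0 := fun x hx => hW' x (by rw [hW]; simp [hx])
    have hW2e : ∀ x ∈ W2, e x = false ∧ v x ≠ 0 := fun x hx => hW' x (by rw [hW]; simp [hx])
    have hW2c : (star A1).card = p - 1 + W2.card := by rw [hW, Multiset.card_add, hW0]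
    obtain ⟨BB, B', hBB, hBc⟩ := sub_card (show 2 ≤ B.card by omega)
    obtain ⟨b, c, rfl⟩ := Multiset.card_eq_two.1 hBc
    have hB'c : B.card = 2 + B'.card := by rw [hBB]; simp; omega
    obtain ⟨b', hb'⟩ := Multiset.card_pos_iff_exists_mem.1 (show 0 < B'.card by omega)
    have hb'e := hBe b' (by rw [hBB]; simp [hb'])
    have hbe := hBe b (by rw [hBB]; simp)
    have hce := hBe c (by rw [hBB]; simp)
    have hSd : S = {g} + (W0 + W2 + A0) + ({b, c} + B') := by
      rw [← hAB, hA1, hBB, ← hW]; congr 2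
    have h1 := tsum_A W0 (fun x hx => (hW0e x hx).1)
    have h2 := tB0 hbe hce
    have hT : ((W0 + {b, c}).map t).sum = 0 ∨ ((W0 + {b, c} + {g}).map t).sum = 0 := by
      simp only [Multiset.map_add, Multiset.sum_add, Multiset.insert_eq_cons, Multiset.map_cons,
        Multiset.map_singleton, Multiset.sum_cons, Multiset.sum_singleton, hg2]
      generalize t b + t c = x at *
      generalize (W0.map t).sum = y at *
      revert x y; decide
    rcases hT with hT | hT
    · refine kill (W0 + {b, c}) ({g} + W2 + A0 + B') (by rw [hSd]; abel) (by simp)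
        (reach hp hodd hT ⟨b, by simp, hbe⟩ ?_) ⟨b', by simp [hb'], hb'e⟩ ?_
      · rw [star_add, star_A hW0e, Multiset.card_add]; omega
      · simp only [star_add, star_A hW2e, Multiset.card_add]; omega
    · refine kill (W0 + {b, c} + {g}) (W2 + A0 + B') (by rw [hSd]; abel) (by simp)
        (reach hp hodd hT ⟨b, by simp, hbe⟩ ?_) ⟨b', by simp [hb'], hb'e⟩ ?_
      · simp only [star_add, star_A hW0e, Multiset.card_add]; omega
      · simp only [star_add, star_A hW2e, Multiset.card_add]; omega
  · have hA0 : ∀ g ∈ A, t g = 0 := by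
      intro g hg'
      rcases t_A (hAe g hg') with h | h
      · exact h
      · exact absurd ⟨g, hg', h⟩ hg
    obtain ⟨W, U, hWU, hW⟩ := sub_card (show p ≤ As.card by omega)
    obtain ⟨T, hTW, hT0, hT⟩ := prefA0 hp hodd W (fun g hg' => hA0 g (by
      rw [← hZA, hWU]; simp [hg'])) hW.ge
    obtain ⟨V, hV⟩ := Multiset.le_iff_exists_add.1 hTW
    have hUc : As.card = p + U.card := by rw [hWU, Multiset.card_add, hW]
    obtain ⟨b, hb, hbe⟩ := hBex
    refine kill T (V + U + Z + B) (by rw [← hAB, ← hZA, hWU, hV]; abel) hT0 hT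
      ⟨b, by simp [hb], hbe⟩ ?_
    have hUe : star U = U := star_A (fun x hx => hAse x (by rw [hWU]; simp [hx]))
    simp only [star_add, hUe, Multiset.card_add]; omega

end QD
end

/-- For the dicyclic group `Q_{4p}` with `p` an odd prime, `D(Q_{4p}) ≤ 3p`. -/
theorem largeDavenport_quaternionGroup_le (p : ℕ) (hp : p.Prime) (hodd : Odd p) :
    largeDavenport (QuaternionGroup p) ≤ (3 * p : ℕ∞) := by
  apply sSup_le
  rintro n ⟨S, ⟨-, hS, hmin⟩, rfl⟩
  have h : S.card ≤ 3 * p := by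
    by_contra h
    exact QD.main hp hodd S hS
      (fun T R h1 h2 h3 h4 h5 => hmin ⟨T, R, h1, h2, h3, h4, h5⟩) (by omega)
  exact_mod_cast h
end
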